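/- arXiv:2201.00450 — 2 statements merged into one kernel-verified Lean document; each statement's English description precedes it below -/
import Mathlib

section
/- For each m, let G_m be a k_m × d_m random matrix whose entries are independent N(0, 1/k_m) random variables, where d_m ≤ k_m, d_m → ∞, k_m → ∞, and d_m/k_m → α with α ∈ (0, 1]. Then the random vector (|1 − λ_min(G_mᵀG_m)|, |1 − λ_max(G_mᵀG_m)|) converges in probability to the constant vector (2√α − α, 2√α + α). -/
open MeasureTheory ProbabilityTheory Matrix Filter
open scoped ENNReal NNReal

/-- Matrices inherit the product measurable structure. -/
instance {m n α : Type*} [MeasurableSpace α] : MeasurableSpace (Matrix m n α) :=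
  inferInstanceAs (MeasurableSpace (m → n → α))

/-- The law of a `k × n` random matrix with independent `N(0, 1/k)` entries
(the Gaussian sketch of size `k`). -/
noncomputable def gaussianMatrix (k n : ℕ) : Measure (Matrix (Fin k) (Fin n) ℝ) :=
  Measure.pi fun _ : Fin k => Measure.pi fun _ : Fin n => gaussianReal 0 (1 / k)

/-- The largest eigenvalue of a square real matrix. -/
noncomputable def lambdaMax {d : ℕ} (M : Matrix (Fin d) (Fin d) ℝ) : ℝ :=
  sSup (spectrum ℝ M)

/-- The smallest eigenvalue of a square real matrix. -/
noncomputable def lambdaMin {d : ℕ} (M : Matrix (Fin d) (Fin d) ℝ) : ℝ :=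
  sInf (spectrum ℝ M)

/-- The law of a vector of `n` independent `N(0, v)` variables. -/
noncomputable def gaussianVector (v : ℝ≥0) (n : ℕ) : Measure (Fin n → ℝ) :=
  Measure.pi fun _ => gaussianReal 0 v

instance (v : ℝ≥0) (n : ℕ) : IsProbabilityMeasure (gaussianVector v n) := by
  unfold gaussianVector; infer_instance

/-- The law of a `k × n` array of independent `N(0, v)` variables. -/
noncomputable def gaussianArray (v : ℝ≥0) (k n : ℕ) : Measure (Fin k → Fin n → ℝ) :=
  Measure.pi fun _ => gaussianVector v n

instance (v : ℝ≥0) (k n : ℕ) : IsProbabilityMeasure (gaussianArray v k n) := by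
  unfold gaussianArray; infer_instance

lemma charFun_gaussianVector (v : ℝ≥0) (n : ℕ) (t : EuclideanSpace ℝ (Fin n)) :
    charFun ((gaussianVector v n).map (WithLp.toLp 2)) t
      = Complex.exp (-((v : ℝ) * ‖t‖ ^ 2 / 2 : ℝ)) := by
  rw [gaussianVector, charFun_pi]
  simp_rw [charFun_gaussianReal, ← Complex.exp_sum]
  congr 1
  simp only [EuclideanSpace.real_norm_sq_eq]
  push_cast
  rw [Finset.mul_sum, Finset.sum_div, ← Finset.sum_neg_distrib]
  exact Finset.sum_congr rfl fun i _ => by simp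

lemma measurePreserving_vecMul_gaussianVector (v : ℝ≥0) {n : ℕ}
    {V : Matrix (Fin n) (Fin n) ℝ} (hV : Vᵀ * V = 1) :
    MeasurePreserving (fun r => r ᵥ* V) (gaussianVector v n) (gaussianVector v n) := by
  have hmeas : Measurable (fun r : Fin n → ℝ => r ᵥ* V) :=
    (LinearMap.continuous_of_finiteDimensional (Matrix.vecMulLinear V)).measurable
  refine ⟨hmeas, ?_⟩
  have hinj : Function.Injective (fun μ : Measure (Fin n → ℝ) => μ.map (WithLp.toLp 2)) :=
    fun μ ν h => (MeasurableEquiv.toLp 2 (Fin n → ℝ)).map_measurableEquiv_injective h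
  apply hinj
  have : IsProbabilityMeasure ((gaussianVector v n).map fun r => r ᵥ* V) :=
    Measure.isProbabilityMeasure_map hmeas.aemeasurable
  have h2 : Measurable (WithLp.toLp 2 : (Fin n → ℝ) → EuclideanSpace ℝ (Fin n)) :=
    (MeasurableEquiv.toLp 2 (Fin n → ℝ)).measurable
  have i1 := Measure.isProbabilityMeasure_map (μ := gaussianVector v n) h2.aemeasurable
  have i2 := Measure.isProbabilityMeasure_map
    (μ := (gaussianVector v n).map fun r => r ᵥ* V) h2.aemeasurable
  apply Measure.ext_of_charFun
  ext t
  have key : charFun (((gaussianVector v n).map fun r => r ᵥ* V).map (WithLp.toLp 2)) t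
      = charFun ((gaussianVector v n).map (WithLp.toLp 2))
          (WithLp.toLp 2 (V *ᵥ t.ofLp)) := by
    rw [Measure.map_map h2 hmeas, charFun_apply, charFun_apply, integral_map, integral_map]
    · refine integral_congr_ae (ae_of_all _ fun r => ?_)
      simp only [Function.comp, EuclideanSpace.inner_eq_star_dotProduct]
      simp [Matrix.dotProduct_mulVec, dotProduct_comm]
    · exact h2.aemeasurable
    · exact Continuous.aestronglyMeasurable (by fun_prop)
    · exact (h2.comp hmeas).aemeasurable
    · exact Continuous.aestronglyMeasurable (by fun_prop)
  rw [key, charFun_gaussianVector, charFun_gaussianVector]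
  congr 5
  rw [EuclideanSpace.real_norm_sq_eq, EuclideanSpace.real_norm_sq_eq]
  have : (V *ᵥ t.ofLp) ⬝ᵥ (V *ᵥ t.ofLp) = t.ofLp ⬝ᵥ t.ofLp := by
    rw [Matrix.dotProduct_mulVec, Matrix.vecMul_mulVec, ← Matrix.dotProduct_mulVec, hV,
      Matrix.one_mulVec]
  simpa [dotProduct, sq] using this

lemma measurePreserving_mul_gaussianArray (v : ℝ≥0) {k n : ℕ}
    {V : Matrix (Fin n) (Fin n) ℝ} (hV : Vᵀ * V = 1) :
    MeasurePreserving (fun (M : Fin k → Fin n → ℝ) i => M i ᵥ* V)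
      (gaussianArray v k n) (gaussianArray v k n) :=
  measurePreserving_pi (fun _ => gaussianVector v n) (fun _ => gaussianVector v n)
    fun _ => measurePreserving_vecMul_gaussianVector v hV

lemma measurePreserving_swap_gaussianArray (v : ℝ≥0) (k n : ℕ) :
    MeasurePreserving (fun (M : Fin k → Fin n → ℝ) j i => M i j)
      (gaussianArray v k n) (gaussianArray v n k) := by
  refine ⟨by fun_prop, Eq.symm ?_⟩
  refine Measure.pi_eq_generateFrom (fun _ => generateFrom_pi) (fun _ => isPiSystem_pi)
    (fun _ => ⟨fun _ => Set.univ, fun _ => ⟨fun _ => Set.univ, by simp, by simp⟩,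
      fun _ => measure_lt_top _ _, Set.iUnion_const _⟩) fun s hs => ?_
  choose t ht hts using hs
  obtain rfl : (fun i => Set.univ.pi (t i)) = s := funext hts
  have hm : ∀ i j, MeasurableSet (t i j) := fun i j => ht i j trivial
  rw [Measure.map_apply (by fun_prop)
    (MeasurableSet.univ_pi fun i => MeasurableSet.univ_pi (hm i))]
  have : (fun (M : Fin k → Fin n → ℝ) j i => M i j) ⁻¹'
      Set.univ.pi (fun i => Set.univ.pi (t i))
      = Set.univ.pi fun j => Set.univ.pi fun i => t i j := by
    ext M
    simp only [Set.mem_preimage, Set.mem_univ_pi]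
    exact forall_comm
  rw [this]
  simp_rw [gaussianArray, gaussianVector, Measure.pi_pi]
  exact Finset.prod_comm

lemma one_le_one_sub_mul_exp {u : ℝ} (hu : |u| ≤ 1 / 2) :
    1 ≤ (1 - u) * Real.exp (u + u ^ 2) := by
  obtain ⟨h1, h2⟩ := abs_le.mp hu
  rcases le_total u 0 with h | h
  · have := Real.add_one_le_exp (u + u ^ 2)
    nlinarith [pow_nonneg (neg_nonneg.mpr h) 3]
  · have := Real.quadratic_le_exp_of_nonneg (x := u + u ^ 2) (by positivity)
    have h3 : 0 ≤ -u + (1 - u) * (1 + u) ^ 2 / 2 := by nlinarith [mul_nonneg h h]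
    nlinarith [mul_nonneg (sq_nonneg u) h3]

lemma gaussianReal_exp_sq {v : ℝ≥0} (hv : v ≠ 0) {t : ℝ} (ht : |t| ≤ 1 / 4) :
    Integrable (fun x => Real.exp (t * (x ^ 2 / v - 1))) (gaussianReal 0 v) ∧
      ∫ x, Real.exp (t * (x ^ 2 / v - 1)) ∂gaussianReal 0 v ≤ Real.exp (2 * t ^ 2) := by
  obtain ⟨h1, h2⟩ := abs_le.mp ht
  have hv0 : (0 : ℝ) < v := by positivity
  have hb : 0 < (1 - 2 * t) / (2 * v) := by
    apply div_pos <;> linarith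
  have hpt : ∀ x : ℝ, gaussianPDFReal 0 v x * Real.exp (t * (x ^ 2 / v - 1))
      = ((√(2 * Real.pi * v))⁻¹ * Real.exp (-t)) *
        Real.exp (-((1 - 2 * t) / (2 * v)) * x ^ 2) := by
    intro x
    rw [gaussianPDFReal, mul_assoc (_⁻¹), mul_assoc (_⁻¹), ← Real.exp_add, ← Real.exp_add]
    congr 2
    field_simp
    ring
  constructor
  · rw [gaussianReal_of_var_ne_zero _ hv,
      integrable_withDensity_iff (measurable_gaussianPDF _ _)
        (ae_of_all _ fun _ => gaussianPDF_lt_top)]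
    simp_rw [toReal_gaussianPDF, mul_comm (Real.exp _), hpt]
    exact (integrable_exp_neg_mul_sq hb).const_mul _
  · rw [integral_gaussianReal_eq_integral_smul hv]
    simp_rw [smul_eq_mul, hpt]
    rw [integral_const_mul, integral_gaussian]
    have h3 : Real.pi / ((1 - 2 * t) / (2 * v)) = (2 * Real.pi * v) / (1 - 2 * t) := by
      have : 1 - 2 * t ≠ 0 := by linarith
      field_simp
    have h4 : (0 : ℝ) < 1 - 2 * t := by linarith
    have h5 : 0 < √(2 * Real.pi * v) := by positivity
    rw [h3, Real.sqrt_div (by positivity)]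
    have h6 : (√(2 * Real.pi * v))⁻¹ * Real.exp (-t) *
        (√(2 * Real.pi * v) / √(1 - 2 * t)) = Real.exp (-t) / √(1 - 2 * t) := by
      field_simp
    rw [h6, div_le_iff₀ (by positivity)]
    have h7 := one_le_one_sub_mul_exp (u := 2 * t) (by rw [abs_mul]; norm_num; linarith)
    have h8 : Real.exp (-t) = Real.exp (2 * t ^ 2) * Real.exp (-t - 2 * t ^ 2) := by
      rw [← Real.exp_add]; ring_nf
    rw [h8]
    gcongr
    apply Real.le_sqrt_of_sq_le
    rw [← Real.exp_nat_mul]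
    have h9 : Real.exp ((2 : ℕ) * (-t - 2 * t ^ 2)) * Real.exp (2 * t + (2 * t) ^ 2) = 1 := by
      rw [← Real.exp_add]
      convert Real.exp_zero using 2
      push_cast; ring
    have h10 := Real.exp_pos ((2 : ℕ) * (-t - 2 * t ^ 2))
    nlinarith

lemma gaussianVector_tail {v : ℝ≥0} (hv : v ≠ 0) (n : ℕ) {t : ℝ} (ht : |t| ≤ 1 / 4) (u : ℝ) :
    (gaussianVector v n).real {r | u ≤ t * (r ⬝ᵥ r / v - n)}
      ≤ Real.exp (2 * t ^ 2 * n - u) := by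
  obtain ⟨hint, hle⟩ := gaussianReal_exp_sq hv ht
  have hprod : ∀ r : Fin n → ℝ,
      Real.exp (t * (r ⬝ᵥ r / v - n)) = ∏ i, Real.exp (t * (r i ^ 2 / v - 1)) := by
    intro r
    rw [← Real.exp_sum, ← Finset.mul_sum, Finset.sum_sub_distrib, ← Finset.sum_div]
    simp [dotProduct, sq]
  have hI : Integrable (fun r : Fin n → ℝ => Real.exp (t * (r ⬝ᵥ r / v - n)))
      (gaussianVector v n) := by
    simp_rw [hprod]
    exact Integrable.fintype_prod fun _ => hint
  have hE : ∫ r, Real.exp (t * (r ⬝ᵥ r / v - n)) ∂gaussianVector v n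
      ≤ Real.exp (2 * t ^ 2 * n) := by
    simp_rw [hprod]
    rw [gaussianVector, integral_fintype_prod_eq_prod
      (f := fun _ x => Real.exp (t * (x ^ 2 / v - 1))), Finset.prod_const, Finset.card_univ,
      Fintype.card_fin]
    calc _ ≤ Real.exp (2 * t ^ 2) ^ n := by
          gcongr
      _ = _ := by rw [← Real.exp_nat_mul]; ring_nf
  have hM := mul_meas_ge_le_integral_of_nonneg (μ := gaussianVector v n)
    (ae_of_all _ fun r => (Real.exp_pos (t * (r ⬝ᵥ r / v - n))).le) hI (Real.exp u)
  simp_rw [Real.exp_le_exp] at hM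
  rw [Real.exp_sub, le_div_iff₀ (Real.exp_pos u)]
  linarith

lemma gaussianVector_norm_concentration {v : ℝ≥0} (hv : v ≠ 0) {n : ℕ} (hn : n * (v : ℝ) ≤ 1)
    {ε : ℝ} (hε0 : 0 < ε) (hε1 : ε ≤ 1) :
    (gaussianVector v n).real {r | ε < |r ⬝ᵥ r - n * v|}
      ≤ 2 * Real.exp (-(ε ^ 2 / (8 * v))) := by
  have hv0 : (0 : ℝ) < v := by positivity
  have hsub : {r : Fin n → ℝ | ε < |r ⬝ᵥ r - n * v|} ⊆
      {r | ε ^ 2 / (4 * v) ≤ ε / 4 * (r ⬝ᵥ r / v - n)} ∪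
      {r | ε ^ 2 / (4 * v) ≤ -(ε / 4) * (r ⬝ᵥ r / v - n)} := by
    intro r hr
    rw [Set.mem_ofPred_eq] at hr
    have e1 : ∀ c : ℝ, c * (r ⬝ᵥ r / v - n) = c * (r ⬝ᵥ r - n * v) / v := by
      intro c; field_simp
    have e2 : ε ^ 2 / (4 * v) = (ε / 4 * ε) / v := by field_simp
    simp only [Set.mem_union, Set.mem_ofPred_eq, e1, e2]
    rcases lt_abs.mp hr with h | h
    · left; gcongr
    · right
      rw [neg_mul, ← mul_neg]
      gcongr
  have hexp : ∀ t : ℝ, t ^ 2 = (ε / 4) ^ 2 →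
      Real.exp (2 * t ^ 2 * n - ε ^ 2 / (4 * v)) ≤ Real.exp (-(ε ^ 2 / (8 * v))) := by
    intro t ht
    have h1 : (n : ℝ) ≤ 1 / v := by rwa [le_div_iff₀ hv0]
    have h2 : 2 * (ε / 4) ^ 2 * (n : ℝ) ≤ 2 * (ε / 4) ^ 2 * (1 / v) := by gcongr
    have h3 : 2 * (ε / 4) ^ 2 * (1 / (v : ℝ)) = ε ^ 2 / (8 * v) := by field_simp; norm_num
    have h4 : ε ^ 2 / (4 * (v : ℝ)) = 2 * (ε ^ 2 / (8 * v)) := by field_simp; norm_num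
    rw [ht]
    gcongr
    linarith
  have h14 : |ε / 4| ≤ 1 / 4 := by rw [abs_of_pos (by positivity)]; linarith
  calc (gaussianVector v n).real {r | ε < |r ⬝ᵥ r - n * v|}
      ≤ _ := measureReal_mono hsub
    _ ≤ _ := measureReal_union_le _ _
    _ ≤ Real.exp (-(ε ^ 2 / (8 * v))) + Real.exp (-(ε ^ 2 / (8 * v))) := by
      refine add_le_add ((gaussianVector_tail hv n h14 _).trans (hexp _ rfl))
        ((gaussianVector_tail hv n ?_ _).trans (hexp _ (by ring)))
      rwa [abs_neg]
    _ = _ := by ring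

/-- The vector whose entry at index `0` is `c` and whose other entries vanish. -/
def headVec (n : ℕ) (c : ℝ) : Fin n → ℝ := fun j => if (j : ℕ) = 0 then c else 0

lemma headVec_dotProduct_self {n : ℕ} (r : Fin n → ℝ) :
    headVec n √(r ⬝ᵥ r) ⬝ᵥ headVec n √(r ⬝ᵥ r) = r ⬝ᵥ r := by
  have h0 : 0 ≤ r ⬝ᵥ r := by
    simpa [dotProduct] using Finset.sum_nonneg fun i _ => mul_self_nonneg (r i)
  cases n with
  | zero => simp [dotProduct]
  | succ n =>
    conv_lhs => rw [dotProduct, Fin.sum_univ_succ]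
    simp [headVec, Real.mul_self_sqrt h0]

/-- A Householder reflection taking `r` to a nonnegative multiple of the first basis vector. -/
lemma exists_orthogonal_vecMul_eq_headVec {n : ℕ} (r : Fin n → ℝ) :
    ∃ V : Matrix (Fin n) (Fin n) ℝ, Vᵀ * V = 1 ∧ r ᵥ* V = headVec n √(r ⬝ᵥ r) := by
  set w := headVec n √(r ⬝ᵥ r) with hw
  have hww : w ⬝ᵥ w = r ⬝ᵥ r := headVec_dotProduct_self r
  by_cases hv : r - w = 0
  · exact ⟨1, by simp, by simpa using sub_eq_zero.mp hv⟩
  set x := r - w with hx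
  have hxx : x ⬝ᵥ x ≠ 0 := fun h => hv (dotProduct_self_eq_zero.mp h)
  have hrx : 2 * (r ⬝ᵥ x) = x ⬝ᵥ x := by
    simp only [hx, sub_dotProduct, dotProduct_sub, hww, dotProduct_comm w r]
    ring
  refine ⟨1 - (2 / (x ⬝ᵥ x)) • vecMulVec x x, ?_, ?_⟩
  · rw [transpose_sub, transpose_smul, transpose_vecMulVec, transpose_one, sub_mul, mul_sub,
      mul_sub, smul_mul_smul_comm, vecMulVec_mul_vecMulVec]
    ext i j
    simp [vecMulVec_apply]
    field_simp
    ring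
  · rw [vecMul_sub, vecMul_one, vecMul_smul, vecMul_vecMulVec]
    ext i
    simp only [Pi.sub_apply, Pi.smul_apply, smul_eq_mul]
    have : 2 / (x ⬝ᵥ x) * (r ⬝ᵥ x * x i) = x i := by
      rw [← mul_assoc, div_mul_eq_mul_div, hrx, div_self hxx, one_mul]
    rw [this, hx]
    simp

/-- The lower bidiagonal matrix with diagonal `s 0, s 2, …` and subdiagonal `s 1, s 3, …`. -/
def bidiagonal (k d : ℕ) (s : ℕ → ℝ) : Fin k → Fin d → ℝ := fun i j =>
  if (i : ℕ) = j then s (2 * j) else if (i : ℕ) = j + 1 then s (2 * j + 1) else 0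

lemma bidiagonal_succ (k d : ℕ) (s : ℕ → ℝ) :
    bidiagonal (k + 1) d s = (Fin.cons (headVec d (s 0))
      (fun i j => bidiagonal d k (fun l => s (l + 1)) j i) : Fin (k + 1) → Fin d → ℝ) := by
  ext i j
  refine Fin.cases ?_ (fun i => ?_) i
  · simp only [bidiagonal, headVec, Fin.cons_zero, Fin.val_zero]
    by_cases h : (j : ℕ) = 0
    · simp [h]
    · simp [h, Ne.symm h]
  · simp only [bidiagonal, Fin.cons_succ, Fin.val_succ]
    by_cases h1 : (j : ℕ) = i
    · simp [h1]
    · by_cases h2 : (j : ℕ) = i + 1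
      · simp [h2, mul_add]
      · rw [if_neg (Ne.symm h2), if_neg (by omega), if_neg h1, if_neg h2]

/-- Invariance under right orthogonal multiplication and under left orthogonal multiplication by
matrices that fix the first basis vector. -/
def OrthogonalInvariant {k d : ℕ} (A : Set (Fin k → Fin d → ℝ)) : Prop :=
  ∀ (U : Matrix (Fin k) (Fin k) ℝ) (V : Matrix (Fin d) (Fin d) ℝ), Uᵀ * U = 1 → Vᵀ * V = 1 →
    (∀ c, U *ᵥ headVec k c = headVec k c) → ∀ M ∈ A, (U * Matrix.of M * V : Matrix _ _ ℝ) ∈ A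

/-- The block diagonal matrix `1 ⊕ U`. -/
def oneBlock {k : ℕ} (U : Matrix (Fin k) (Fin k) ℝ) : Matrix (Fin (k + 1)) (Fin (k + 1)) ℝ :=
  Matrix.of (Fin.cons (Fin.cons 1 0 : Fin (k + 1) → ℝ)
    (fun i => (Fin.cons 0 (U i) : Fin (k + 1) → ℝ)) : Fin (k + 1) → Fin (k + 1) → ℝ)

lemma oneBlock_transpose_mul_self {k : ℕ} {U : Matrix (Fin k) (Fin k) ℝ} (hU : Uᵀ * U = 1) :
    (oneBlock U)ᵀ * oneBlock U = 1 := by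
  ext i j
  have h : ∀ a b, ∑ l, U l a * U l b = (1 : Matrix (Fin k) (Fin k) ℝ) a b := by
    intro a b
    rw [← hU]
    simp [Matrix.mul_apply]
  refine Fin.cases ?_ (fun i => ?_) i <;> refine Fin.cases ?_ (fun j => ?_) j <;>
    simp [oneBlock, Matrix.mul_apply, Fin.sum_univ_succ, h, Matrix.one_apply, Fin.ext_iff]

lemma oneBlock_mulVec_headVec {k : ℕ} (U : Matrix (Fin k) (Fin k) ℝ) (c : ℝ) :
    oneBlock U *ᵥ headVec (k + 1) c = headVec (k + 1) c := by
  ext i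
  refine Fin.cases ?_ (fun i => ?_) i <;>
    simp [oneBlock, Matrix.mulVec, dotProduct, headVec]

lemma oneBlock_mul_cons_mul {k d : ℕ} (U : Matrix (Fin k) (Fin k) ℝ)
    (V : Matrix (Fin d) (Fin d) ℝ) (r : Fin d → ℝ) (M : Fin k → Fin d → ℝ) :
    oneBlock U * Matrix.of (Fin.cons r M : Fin (k + 1) → Fin d → ℝ) * V
      = Matrix.of (Fin.cons (r ᵥ* V) (U * Matrix.of M * V : Matrix _ _ ℝ) :
          Fin (k + 1) → Fin d → ℝ) := by
  ext i j
  refine Fin.cases ?_ (fun i => ?_) i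
  · change _ = (r ᵥ* V) j
    simp [oneBlock, Matrix.mul_apply, Matrix.vecMul, dotProduct, Fin.sum_univ_succ]
  · change _ = (U * Matrix.of M * V) i j
    simp [oneBlock, Matrix.mul_apply, Fin.sum_univ_succ]

lemma OrthogonalInvariant.preimage_cons {k d : ℕ} {A : Set (Fin (k + 1) → Fin d → ℝ)}
    (hA : OrthogonalInvariant A) (c : ℝ) :
    OrthogonalInvariant {N : Fin d → Fin k → ℝ |
      (Fin.cons (headVec d c) (fun i j => N j i) : Fin (k + 1) → Fin d → ℝ) ∈ A} := by
  intro U V hU hV hh N hN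
  have h := hA (oneBlock Vᵀ) Uᵀ
    (oneBlock_transpose_mul_self (by rw [transpose_transpose]; exact mul_eq_one_comm.mp hV))
    (by rw [transpose_transpose]; exact mul_eq_one_comm.mp hU)
    (oneBlock_mulVec_headVec _) _ hN
  rw [oneBlock_mul_cons_mul, vecMul_transpose, hh] at h
  have ht : (U * Matrix.of N * V : Matrix _ _ ℝ)ᵀ = Vᵀ * (Matrix.of N)ᵀ * Uᵀ := by
    rw [transpose_mul, transpose_mul, Matrix.mul_assoc]
  change (Fin.cons (headVec d c) (U * Matrix.of N * V : Matrix _ _ ℝ)ᵀ :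
    Fin (k + 1) → Fin d → ℝ) ∈ A
  rw [ht]
  exact h

lemma measurable_cons {k d : ℕ} :
    Measurable fun p : (Fin d → ℝ) × (Fin k → Fin d → ℝ) =>
      (Fin.cons p.1 p.2 : Fin (k + 1) → Fin d → ℝ) := by
  refine measurable_pi_iff.mpr fun i => ?_
  refine Fin.cases ?_ (fun i => ?_) i
  · simpa using measurable_fst
  · simp only [Fin.cons_succ]
    fun_prop

lemma gaussianArray_succ_apply (v : ℝ≥0) {k d : ℕ} {A : Set (Fin (k + 1) → Fin d → ℝ)}
    (hA : MeasurableSet A) :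
    gaussianArray v (k + 1) d A = ∫⁻ r, gaussianArray v k d
      {M | (Fin.cons r M : Fin (k + 1) → Fin d → ℝ) ∈ A} ∂gaussianVector v d := by
  have h := (measurePreserving_piFinSuccAbove (fun _ : Fin (k + 1) => gaussianVector v d) 0).symm
  have h1 : gaussianArray v (k + 1) d A = _ := (h.measure_preimage hA.nullMeasurableSet).symm
  rw [h1, Measure.prod_apply (h.measurable hA)]
  refine lintegral_congr fun r => congrArg _ ?_
  ext M
  rw [Set.mem_preimage, Set.mem_preimage, Set.mem_ofPred_eq]
  rw [show (MeasurableEquiv.piFinSuccAbove (fun _ => Fin d → ℝ) 0).symm (r, M)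
    = (Fin.cons r M : Fin (k + 1) → Fin d → ℝ) from Fin.insertNth_zero' r M]

lemma gaussianArray_slice_le (v : ℝ≥0) {k d : ℕ} {A : Set (Fin (k + 1) → Fin d → ℝ)}
    (hAm : MeasurableSet A) (hA : OrthogonalInvariant A) (r : Fin d → ℝ) :
    gaussianArray v k d {M | (Fin.cons r M : Fin (k + 1) → Fin d → ℝ) ∈ A} ≤
      gaussianArray v d k {N | (Fin.cons (headVec d √(r ⬝ᵥ r)) (fun i j => N j i) :
        Fin (k + 1) → Fin d → ℝ) ∈ A} := by
  obtain ⟨V, hV, hr⟩ := exists_orthogonal_vecMul_eq_headVec r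
  have hm : MeasurableSet {M : Fin k → Fin d → ℝ |
      (Fin.cons (headVec d √(r ⬝ᵥ r)) M : Fin (k + 1) → Fin d → ℝ) ∈ A} :=
    measurable_cons.comp measurable_prodMk_left hAm
  have e1 := (measurePreserving_swap_gaussianArray v d k).measure_preimage hm.nullMeasurableSet
  have e2 := (measurePreserving_mul_gaussianArray v (k := k) hV).measure_preimage
    hm.nullMeasurableSet
  refine le_trans (measure_mono fun M hM => ?_) (e2.trans e1.symm).le
  have h := hA 1 V (by simp) hV (by simp) _ hM
  change (Fin.cons (headVec d √(r ⬝ᵥ r)) (fun i => M i ᵥ* V) : Fin (k + 1) → Fin d → ℝ) ∈ A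
  have he : (1 : Matrix (Fin (k + 1)) (Fin (k + 1)) ℝ) *
      Matrix.of (Fin.cons r M : Fin (k + 1) → Fin d → ℝ) * V
      = Matrix.of (Fin.cons (r ᵥ* V) fun i => M i ᵥ* V : Fin (k + 1) → Fin d → ℝ) := by
    ext i j
    rw [Matrix.one_mul, Matrix.mul_apply_eq_vecMul]
    refine Fin.cases ?_ (fun i => ?_) i <;> rfl
  rw [he, hr] at h
  exact h

/-- An orthogonally invariant event that contains no bidiagonal matrix with entries in prescribed
ranges is at most as likely as some entry of the random bidiagonalization, which is the norm of a
Gaussian vector, leaving its range. -/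
theorem gaussianArray_le_of_bidiagonal (v : ℝ≥0) {T : ℕ → Set ℝ} (hTm : ∀ n, MeasurableSet (T n))
    (hTne : ∀ n, (T n).Nonempty) {N : ℕ} {η : ℝ≥0∞}
    (hη : ∀ n ≤ N, gaussianVector v n {r | √(r ⬝ᵥ r) ∉ T n} ≤ η)
    (k d : ℕ) (hk : k ≤ N) (hd : d ≤ N) (A : Set (Fin k → Fin d → ℝ)) (hAm : MeasurableSet A)
    (hA : OrthogonalInvariant A)
    (hbi : ∀ s : ℕ → ℝ, (∀ i, s (2 * i) ∈ T (d - i)) → (∀ i, s (2 * i + 1) ∈ T (k - 1 - i)) →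
      bidiagonal k d s ∉ A) :
    gaussianArray v k d A ≤ (k + d : ℕ) * η := by
  induction hL : k + d generalizing k d with
  | zero =>
    obtain rfl : k = 0 := by omega
    choose f hf using hTne
    have hA0 : A = ∅ := by
      refine Set.eq_empty_of_forall_notMem fun M hM => ?_
      refine hbi (fun i => if i % 2 = 0 then f (d - i / 2) else f (0 - 1 - i / 2)) ?_ ?_ ?_
      · intro i; simpa using hf _
      · intro i; simpa [Nat.add_mod] using hf _
      · rwa [Subsingleton.elim (bidiagonal _ _ _) M]
    simp [hA0]
  | succ L ih =>
    cases k with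
    | zero =>
      choose f hf using hTne
      have hA0 : A = ∅ := by
        refine Set.eq_empty_of_forall_notMem fun M hM => ?_
        refine hbi (fun i => if i % 2 = 0 then f (d - i / 2) else f (0 - 1 - i / 2)) ?_ ?_ ?_
        · intro i; simpa using hf _
        · intro i; simpa [Nat.add_mod] using hf _
        · rwa [Subsingleton.elim (bidiagonal _ _ _) M]
      simp [hA0]
    | succ k =>
      have hTd : MeasurableSet {r : Fin d → ℝ | √(r ⬝ᵥ r) ∉ T d} := by
        have : Measurable fun r : Fin d → ℝ => √(r ⬝ᵥ r) := by
          unfold dotProduct; fun_prop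
        exact (this (hTm d)).compl
      have hslice : ∀ r : Fin d → ℝ,
          gaussianArray v k d {M | (Fin.cons r M : Fin (k + 1) → Fin d → ℝ) ∈ A} ≤
            {r | √(r ⬝ᵥ r) ∉ T d}.indicator 1 r + (L : ℕ) * η := by
        intro r
        by_cases hr : √(r ⬝ᵥ r) ∈ T d
        · refine (gaussianArray_slice_le v hAm hA r).trans (le_add_left ?_)
          refine ih d k hd (by omega) _ ?_ (hA.preimage_cons _) ?_ (by omega)
          · refine measurable_cons.comp (measurable_const.prodMk ?_) hAm
            fun_prop
          · intro s hs0 hs1 hmem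
            refine hbi (fun i => Nat.casesOn i √(r ⬝ᵥ r) s) ?_ ?_ ?_
            · intro i
              cases i with
              | zero => exact hr
              | succ i =>
                have := hs1 i
                rwa [Nat.sub_sub, add_comm 1 i] at this
            · intro i
              simpa using hs0 i
            · rw [bidiagonal_succ]
              exact hmem
        · refine prob_le_one.trans (le_add_right ?_)
          rw [Set.indicator_of_mem (by exact hr)]
          rfl
      calc gaussianArray v (k + 1) d A
          ≤ ∫⁻ r, ({r | √(r ⬝ᵥ r) ∉ T d}.indicator 1 r + (L : ℕ) * η) ∂gaussianVector v d := by
            rw [gaussianArray_succ_apply v hAm]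
            exact lintegral_mono hslice
        _ = gaussianVector v d {r | √(r ⬝ᵥ r) ∉ T d} + (L : ℕ) * η := by
            rw [lintegral_add_right _ measurable_const, lintegral_indicator_one hTd]
            simp
        _ ≤ η + (L : ℕ) * η := by gcongr; exact hη d hd
        _ = (L + 1 : ℕ) * η := by push_cast; ring

/-- The squared norm of the product of an upper bidiagonal matrix with a vector. -/
def bandForm (a b X : ℕ → ℝ) (d : ℕ) : ℝ :=
  ∑ j ∈ Finset.range d, (a j * X j + b j * X (j + 1)) ^ 2

lemma sum_sq_shift_le {X : ℕ → ℝ} {d : ℕ} (hX : X d = 0) :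
    ∑ j ∈ Finset.range d, X (j + 1) ^ 2 ≤ ∑ j ∈ Finset.range d, X j ^ 2 := by
  have h1 := Finset.sum_range_succ (fun j => X j ^ 2) d
  have h2 := Finset.sum_range_succ' (fun j => X j ^ 2) d
  simp only [hX] at h1
  nlinarith [sq_nonneg (X 0)]

lemma abs_bandForm_sub_le {a b α β X : ℕ → ℝ} {d : ℕ} {η : ℝ} (hη0 : 0 ≤ η) (hη1 : η ≤ 1)
    (hα : ∀ j < d, |α j| ≤ 1) (hβ : ∀ j < d, |β j| ≤ 1)
    (ha : ∀ j < d, |a j - α j| ≤ η) (hb : ∀ j < d, |b j - β j| ≤ η) (hX : X d = 0) :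
    |bandForm a b X d - bandForm α β X d| ≤ 12 * η * ∑ j ∈ Finset.range d, X j ^ 2 := by
  have hterm : ∀ j ∈ Finset.range d,
      |(a j * X j + b j * X (j + 1)) ^ 2 - (α j * X j + β j * X (j + 1)) ^ 2|
        ≤ 6 * η * (X j ^ 2 + X (j + 1) ^ 2) := by
    intro j hj
    rw [Finset.mem_range] at hj
    set x := |X j| + |X (j + 1)| with hx
    have hx0 : 0 ≤ x := by positivity
    have hu : |α j * X j + β j * X (j + 1)| ≤ x := by
      refine (abs_add_le _ _).trans ?_
      rw [abs_mul, abs_mul]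
      nlinarith [hα j hj, hβ j hj, abs_nonneg (X j), abs_nonneg (X (j + 1))]
    have he : |(a j - α j) * X j + (b j - β j) * X (j + 1)| ≤ η * x := by
      refine (abs_add_le _ _).trans ?_
      rw [abs_mul, abs_mul]
      nlinarith [ha j hj, hb j hj, abs_nonneg (X j), abs_nonneg (X (j + 1))]
    have heq : (a j * X j + b j * X (j + 1)) ^ 2 - (α j * X j + β j * X (j + 1)) ^ 2
        = ((a j - α j) * X j + (b j - β j) * X (j + 1)) *
          (2 * (α j * X j + β j * X (j + 1)) +
            ((a j - α j) * X j + (b j - β j) * X (j + 1))) := by ring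
    rw [heq, abs_mul]
    have h2 : |2 * (α j * X j + β j * X (j + 1)) +
        ((a j - α j) * X j + (b j - β j) * X (j + 1))| ≤ 3 * x := by
      refine (abs_add_le _ _).trans ?_
      rw [abs_mul, abs_two]
      nlinarith
    calc _ ≤ (η * x) * (3 * x) := by gcongr
      _ = 3 * η * x ^ 2 := by ring
      _ ≤ 3 * η * (2 * (|X j| ^ 2 + |X (j + 1)| ^ 2)) := by
        gcongr
        nlinarith [sq_nonneg (|X j| - |X (j + 1)|)]
      _ = _ := by rw [sq_abs, sq_abs]; ring
  rw [bandForm, bandForm, ← Finset.sum_sub_distrib]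
  refine (Finset.abs_sum_le_sum_abs _ _).trans ((Finset.sum_le_sum hterm).trans ?_)
  rw [← Finset.mul_sum, Finset.sum_add_distrib]
  nlinarith [mul_le_mul_of_nonneg_left (sum_sq_shift_le hX) hη0]

lemma bandForm_upper {α β X : ℕ → ℝ} {d : ℕ} {c : ℝ} (hα0 : ∀ j < d, 0 ≤ α j)
    (hα1 : ∀ j < d, α j ≤ 1) (hβ0 : ∀ j < d, 0 ≤ β j) (hβ : ∀ j < d, β j ≤ c) (hc : 0 ≤ c)
    (hX : X d = 0) :
    bandForm α β X d ≤ (1 + c) ^ 2 * ∑ j ∈ Finset.range d, X j ^ 2 := by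
  have hterm : ∀ j ∈ Finset.range d, (α j * X j + β j * X (j + 1)) ^ 2
      ≤ (1 + c) * X j ^ 2 + (c + c ^ 2) * X (j + 1) ^ 2 := by
    intro j hj
    rw [Finset.mem_range] at hj
    have h1 : |α j * X j + β j * X (j + 1)| ≤ |X j| + c * |X (j + 1)| := by
      refine (abs_add_le _ _).trans ?_
      rw [abs_mul, abs_mul, abs_of_nonneg (hα0 j hj), abs_of_nonneg (hβ0 j hj)]
      nlinarith [hα1 j hj, hβ j hj, abs_nonneg (X j), abs_nonneg (X (j + 1))]
    calc _ = |α j * X j + β j * X (j + 1)| ^ 2 := (sq_abs _).symm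
      _ ≤ (|X j| + c * |X (j + 1)|) ^ 2 := by gcongr
      _ ≤ (1 + c) * |X j| ^ 2 + (c + c ^ 2) * |X (j + 1)| ^ 2 := by
        nlinarith [mul_nonneg hc (sq_nonneg (|X j| - |X (j + 1)|))]
      _ = _ := by rw [sq_abs, sq_abs]
  refine (Finset.sum_le_sum hterm).trans ?_
  rw [Finset.sum_add_distrib, ← Finset.mul_sum, ← Finset.mul_sum]
  have : 0 ≤ c + c ^ 2 := by positivity
  nlinarith [mul_le_mul_of_nonneg_left (sum_sq_shift_le hX) this]

lemma bandForm_lower {α β X : ℕ → ℝ} {d : ℕ} {c : ℝ} (hα0 : ∀ j < d, 0 < α j)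
    (hβ0 : ∀ j < d, 0 ≤ β j) (hβ : ∀ j < d, β j ≤ c * α j)
    (hαβ : ∀ j < d, α j ^ 2 - β j ^ 2 = 1 - c ^ 2) (hc0 : 0 ≤ c) (hc1 : c ≤ 1)
    (hX : X d = 0) :
    (1 - c) ^ 2 * ∑ j ∈ Finset.range d, X j ^ 2 ≤ bandForm α β X d := by
  have hterm : ∀ j ∈ Finset.range d, (1 - c) * X j ^ 2 - (c - c ^ 2) * X (j + 1) ^ 2
      ≤ (α j * X j + β j * X (j + 1)) ^ 2 := by
    intro j hj
    rw [Finset.mem_range] at hj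
    have hα := hα0 j hj
    have hb := hβ0 j hj
    have hs : 0 < α j + β j := by positivity
    have hfac : (α j - β j) * (α j + β j) = (1 - c) * (1 + c) := by linarith [hαβ j hj]
    have h1 : 1 - c ≤ α j * (α j - β j) := by
      have : (1 - c) * (α j + β j) ≤ α j * (α j - β j) * (α j + β j) := by
        rw [mul_assoc, hfac]
        nlinarith [mul_nonneg (sub_nonneg.mpr hc1) (sub_nonneg.mpr (hβ j hj))]
      exact le_of_mul_le_mul_right this hs
    have h2 : β j * (α j - β j) ≤ c - c ^ 2 := by
      have : β j * (α j - β j) * (α j + β j) ≤ (c - c ^ 2) * (α j + β j) := by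
        rw [mul_assoc, hfac]
        nlinarith [mul_nonneg (sub_nonneg.mpr hc1) (sub_nonneg.mpr (hβ j hj))]
      exact le_of_mul_le_mul_right this hs
    nlinarith [mul_nonneg (mul_nonneg hα.le hb) (sq_nonneg (X j + X (j + 1))),
      mul_le_mul_of_nonneg_right h1 (sq_nonneg (X j)),
      mul_le_mul_of_nonneg_right h2 (sq_nonneg (X (j + 1)))]
  refine le_trans ?_ (Finset.sum_le_sum hterm)
  rw [Finset.sum_sub_distrib, ← Finset.mul_sum, ← Finset.mul_sum]
  have : 0 ≤ c - c ^ 2 := by nlinarith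
  nlinarith [mul_le_mul_of_nonneg_left (sum_sq_shift_le hX) this]

/-- The vector `(1, σ, σ², …, σⁿ, 0, 0, …)`. -/
def truncPow (σ : ℝ) (n : ℕ) : ℕ → ℝ := fun j => if j ≤ n then σ ^ j else 0

lemma sum_sq_truncPow {σ : ℝ} (hσ : σ ^ 2 = 1) {n d : ℕ} (hn : n < d) :
    ∑ j ∈ Finset.range d, truncPow σ n j ^ 2 = n + 1 := by
  have h : ∑ j ∈ Finset.range (n + 1), truncPow σ n j ^ 2
      = ∑ j ∈ Finset.range d, truncPow σ n j ^ 2 := by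
    refine Finset.sum_subset (Finset.range_subset_range.mpr hn) fun j _ hj => ?_
    simp [truncPow, show ¬ j ≤ n by simpa [Nat.lt_succ_iff] using hj]
  rw [← h, Finset.sum_congr rfl (g := fun _ => (1 : ℝ))]
  · simp
  · intro j hj
    rw [truncPow, if_pos (by simpa [Nat.lt_succ_iff] using hj), ← pow_mul, mul_comm, pow_mul,
      hσ, one_pow]

lemma bandForm_truncPow {α β : ℕ → ℝ} {σ : ℝ} (hσ : σ ^ 2 = 1) {n d : ℕ} (hn : n < d) :
    bandForm α β (truncPow σ n) d
      = ∑ j ∈ Finset.range n, (α j + σ * β j) ^ 2 + α n ^ 2 := by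
  have hp : ∀ j, (σ ^ j) ^ 2 = 1 := fun j => by
    rw [← pow_mul, mul_comm, pow_mul, hσ, one_pow]
  have h : ∑ j ∈ Finset.range (n + 1),
      (α j * truncPow σ n j + β j * truncPow σ n (j + 1)) ^ 2 = bandForm α β (truncPow σ n) d := by
    refine Finset.sum_subset (Finset.range_subset_range.mpr hn) fun j _ hj => ?_
    have : n < j := by simpa [Nat.lt_succ_iff] using hj
    simp [truncPow, this.not_ge, show ¬ j + 1 ≤ n by omega]
  rw [← h, Finset.sum_range_succ]
  congr 1
  · refine Finset.sum_congr rfl fun j hj => ?_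
    rw [Finset.mem_range] at hj
    rw [truncPow, truncPow, if_pos hj.le, if_pos (Nat.succ_le_of_lt hj)]
    linear_combination (α j + σ * β j) ^ 2 * hp j
  · simp only [truncPow, le_refl, if_true, show ¬ n + 1 ≤ n by omega, if_false]
    linear_combination α n ^ 2 * hp n

lemma abs_bandForm_truncPow_sub_le {α β : ℕ → ℝ} {σ : ℝ} (hσ : |σ| = 1) {n d : ℕ} (hn : n < d)
    {c ζ : ℝ} (hc0 : 0 ≤ c) (hc1 : c ≤ 1)
    (hα0 : ∀ j ≤ n, 0 ≤ α j) (hα1 : ∀ j ≤ n, α j ≤ 1) (hα : ∀ j ≤ n, 1 - ζ ≤ α j)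
    (hβ0 : ∀ j ≤ n, 0 ≤ β j) (hβ1 : ∀ j ≤ n, β j ≤ c) (hβ : ∀ j ≤ n, c - ζ ≤ β j) :
    |bandForm α β (truncPow σ n) d - (n + 1) * (1 + σ * c) ^ 2| ≤ 8 * ζ * n + 4 := by
  have hσ2 : σ ^ 2 = 1 := by rw [← sq_abs, hσ, one_pow]
  rw [bandForm_truncPow hσ2 hn]
  have hterm : ∀ j ∈ Finset.range n, |(α j + σ * β j) ^ 2 - (1 + σ * c) ^ 2| ≤ 8 * ζ := by
    intro j hj
    have hj := (Finset.mem_range.mp hj).le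
    rw [sq_sub_sq, abs_mul]
    have h1 : |α j + σ * β j + (1 + σ * c)| ≤ 4 := by
      have := hα0 j hj; have := hα1 j hj; have := hβ0 j hj; have := hβ1 j hj
      rcases (abs_eq zero_le_one).mp hσ with rfl | rfl <;> rw [abs_le] <;> constructor <;> linarith
    have h2 : |α j + σ * β j - (1 + σ * c)| ≤ 2 * ζ := by
      have := hα j hj; have := hα1 j hj; have := hβ j hj; have := hβ1 j hj
      rcases (abs_eq zero_le_one).mp hσ with rfl | rfl <;> rw [abs_le] <;> constructor <;> linarith
    calc _ ≤ 4 * (2 * ζ) := by gcongr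
      _ = _ := by ring
  have hlast : |α n ^ 2 - (1 + σ * c) ^ 2| ≤ 4 := by
    have := hα0 n le_rfl; have := hα1 n le_rfl
    rcases (abs_eq zero_le_one).mp hσ with rfl | rfl <;> rw [abs_le] <;> constructor <;> nlinarith
  have heq : ∑ j ∈ Finset.range n, (α j + σ * β j) ^ 2 + α n ^ 2 - (n + 1) * (1 + σ * c) ^ 2
      = ∑ j ∈ Finset.range n, ((α j + σ * β j) ^ 2 - (1 + σ * c) ^ 2)
        + (α n ^ 2 - (1 + σ * c) ^ 2) := by
    rw [Finset.sum_sub_distrib, Finset.sum_const, Finset.card_range, nsmul_eq_mul]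
    ring
  rw [heq]
  refine (abs_add_le _ _).trans (add_le_add ?_ hlast)
  refine (Finset.abs_sum_le_sum_abs _ _).trans ((Finset.sum_le_sum hterm).trans ?_)
  rw [Finset.sum_const, Finset.card_range, nsmul_eq_mul]
  linarith

/-- The extreme values of the quadratic form of a bidiagonal matrix whose entries are close to
`√((k - j) / k)` and `√((d - j) / k)`. -/
lemma bandForm_bounds {k d n : ℕ} (hn : n < d) (hdk : d ≤ k) {a b : ℕ → ℝ} {η δ : ℝ}
    (hη0 : 0 ≤ η) (hη1 : η ≤ 1)
    (ha : ∀ j < d, |a j - √(((k : ℝ) - j) / k)| ≤ η)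
    (hb : ∀ j < d, |b j - √(((d : ℝ) - j) / k)| ≤ η)
    (hδ : 8 * √((n : ℝ) / k) + 4 / (n + 1) + 12 * η < δ) :
    (∀ X : ℕ → ℝ, X d = 0 →
      ((1 - √((d : ℝ) / k)) ^ 2 - δ) * ∑ j ∈ Finset.range d, X j ^ 2 ≤ bandForm a b X d ∧
      bandForm a b X d ≤ ((1 + √((d : ℝ) / k)) ^ 2 + δ) * ∑ j ∈ Finset.range d, X j ^ 2) ∧
    bandForm a b (truncPow (-1) n) d < ((1 - √((d : ℝ) / k)) ^ 2 + δ) *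
      ∑ j ∈ Finset.range d, truncPow (-1) n j ^ 2 ∧
    ((1 + √((d : ℝ) / k)) ^ 2 - δ) * ∑ j ∈ Finset.range d, truncPow 1 n j ^ 2
      < bandForm a b (truncPow 1 n) d := by
  set c := √((d : ℝ) / k) with hc
  set ζ := √((n : ℝ) / k) with hζ
  have hζ0 : 0 ≤ ζ := Real.sqrt_nonneg _
  have hc0 : 0 ≤ c := Real.sqrt_nonneg _
  have hk0 : (0 : ℝ) < k := by exact_mod_cast (by omega : 0 < k)
  have hdk' : (d : ℝ) ≤ k := by exact_mod_cast hdk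
  have hc1 : c ≤ 1 := Real.sqrt_le_one.mpr ((div_le_one hk0).mpr hdk')
  have hjd : ∀ j < d, (j : ℝ) < d := fun j hj => by exact_mod_cast hj
  set α : ℕ → ℝ := fun j => √(((k : ℝ) - j) / k) with hα
  set β : ℕ → ℝ := fun j => √(((d : ℝ) - j) / k) with hβ
  have hα0 : ∀ j < d, 0 < α j := fun j hj =>
    Real.sqrt_pos.mpr (div_pos (by linarith [hjd j hj]) hk0)
  have hα1 : ∀ j, α j ≤ 1 := fun j =>
    Real.sqrt_le_one.mpr ((div_le_one hk0).mpr (by linarith [(Nat.cast_nonneg j : (0 : ℝ) ≤ j)]))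
  have hβ0 : ∀ j, 0 ≤ β j := fun j => Real.sqrt_nonneg _
  have hβc : ∀ j, β j ≤ c := fun j =>
    Real.sqrt_le_sqrt (by gcongr; linarith [(Nat.cast_nonneg j : (0 : ℝ) ≤ j)])
  have hαsq : ∀ j < d, α j ^ 2 = ((k : ℝ) - j) / k := fun j hj =>
    Real.sq_sqrt (div_nonneg (by linarith [hjd j hj]) hk0.le)
  have hβsq : ∀ j < d, β j ^ 2 = ((d : ℝ) - j) / k := fun j hj =>
    Real.sq_sqrt (div_nonneg (by linarith [hjd j hj]) hk0.le)
  have hcsq : c ^ 2 = (d : ℝ) / k := Real.sq_sqrt (by positivity)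
  have hζsq : ζ ^ 2 = (n : ℝ) / k := Real.sq_sqrt (by positivity)
  have hαβ : ∀ j < d, α j ^ 2 - β j ^ 2 = 1 - c ^ 2 := fun j hj => by
    rw [hαsq j hj, hβsq j hj, hcsq]
    field_simp
    ring
  have hβα : ∀ j < d, β j ≤ c * α j := fun j hj => by
    refine abs_le_of_sq_le_sq' ?_ (mul_nonneg hc0 (hα0 j hj).le) |>.2
    rw [mul_pow, hαsq j hj, hβsq j hj, hcsq, div_mul_div_comm, div_le_div_iff₀ hk0 (by positivity)]
    have h1 : (0 : ℝ) ≤ j := Nat.cast_nonneg j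
    nlinarith [mul_nonneg (mul_nonneg hk0.le h1) (sub_nonneg.mpr hdk')]
  have hαζ : ∀ j ≤ n, 1 - ζ ≤ α j := fun j hj => by
    have hj' : j < d := by omega
    have hjn : (j : ℝ) / k ≤ n / k := by gcongr
    have h1 : α j ^ 2 = 1 - (j : ℝ) / k := by rw [hαsq j hj', sub_div, div_self hk0.ne']
    nlinarith [hα0 j hj']
  have hβζ : ∀ j ≤ n, c - ζ ≤ β j := fun j hj => by
    have hj' : j < d := by omega
    have hjn : (j : ℝ) / k ≤ n / k := by gcongr
    have h1 : β j ^ 2 = c ^ 2 - (j : ℝ) / k := by rw [hβsq j hj', sub_div, hcsq]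
    nlinarith [hβ0 j]
  have hpert : ∀ X : ℕ → ℝ, X d = 0 → |bandForm a b X d - bandForm α β X d|
      ≤ 12 * η * ∑ j ∈ Finset.range d, X j ^ 2 := fun X hX =>
    abs_bandForm_sub_le hη0 hη1 (fun j hj => by rw [abs_of_pos (hα0 j hj)]; exact hα1 j)
      (fun j _ => by rw [abs_of_nonneg (hβ0 j)]; exact (hβc j).trans hc1) ha hb hX
  have hn1 : (0 : ℝ) < n + 1 := by positivity
  have h4n : 0 < 4 / ((n : ℝ) + 1) := by positivity
  have htest : ∀ σ : ℝ, |σ| = 1 →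
      |bandForm a b (truncPow σ n) d - (n + 1) * (1 + σ * c) ^ 2| < δ * (n + 1) := by
    intro σ hσ
    have hX : truncPow σ n d = 0 := if_neg (by omega)
    have hσ2 : σ ^ 2 = 1 := by rw [← sq_abs, hσ, one_pow]
    have h1 := hpert _ hX
    rw [sum_sq_truncPow hσ2 hn] at h1
    have h2 := abs_bandForm_truncPow_sub_le hσ hn hc0 hc1 (fun j hj => (hα0 j (by omega)).le)
      (fun j _ => hα1 j) hαζ (fun j _ => hβ0 j) (fun j _ => hβc j) hβζ
    calc _ ≤ _ := abs_sub_le _ (bandForm α β (truncPow σ n) d) _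
      _ ≤ 12 * η * (n + 1) + (8 * ζ * n + 4) := add_le_add h1 h2
      _ ≤ (8 * ζ + 4 / (n + 1) + 12 * η) * (n + 1) := by
        have : 4 / ((n : ℝ) + 1) * (n + 1) = 4 := div_mul_cancel₀ _ hn1.ne'
        nlinarith
      _ < _ := by gcongr
  refine ⟨fun X hX => ?_, ?_, ?_⟩
  · have h1 := abs_le.mp (hpert X hX)
    have h2 := bandForm_lower hα0 (fun j _ => hβ0 j) hβα hαβ hc0 hc1 hX
    have h3 := bandForm_upper (fun j hj => (hα0 j hj).le) (fun j _ => hα1 j) (fun j _ => hβ0 j)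
      (fun j _ => hβc j) hc0 hX
    have h4 : 0 ≤ ∑ j ∈ Finset.range d, X j ^ 2 := Finset.sum_nonneg fun j _ => sq_nonneg _
    have h5 : 12 * η * ∑ j ∈ Finset.range d, X j ^ 2 ≤ δ * ∑ j ∈ Finset.range d, X j ^ 2 := by
      gcongr; linarith
    constructor <;> linarith [h1.1, h1.2]
  · rw [sum_sq_truncPow (by norm_num) hn]
    have := (abs_lt.mp (htest (-1) (by norm_num))).2
    linarith
  · rw [sum_sq_truncPow (by norm_num) hn]
    have := (abs_lt.mp (htest 1 (by norm_num))).1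
    linarith

/-- The quadratic form `x ↦ ‖xᵀ M‖²`. -/
def gramForm {k d : ℕ} (M : Fin k → Fin d → ℝ) (x : Fin k → ℝ) : ℝ :=
  (x ᵥ* Matrix.of M) ⬝ᵥ (x ᵥ* Matrix.of M)

lemma continuous_gramForm {k d : ℕ} (x : Fin k → ℝ) :
    Continuous fun M : Fin k → Fin d → ℝ => gramForm M x := by
  simp only [gramForm, dotProduct, vecMul, Matrix.of_apply]
  fun_prop

lemma vecMul_dotProduct_vecMul_self {n : ℕ} {V : Matrix (Fin n) (Fin n) ℝ}
    (hV : V * Vᵀ = (1 : Matrix (Fin n) (Fin n) ℝ)) (x : Fin n → ℝ) :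
    (x ᵥ* V) ⬝ᵥ (x ᵥ* V) = x ⬝ᵥ x := by
  rw [← mulVec_transpose V x, dotProduct_mulVec, mulVec_transpose, vecMul_vecMul, hV, vecMul_one]

lemma gramForm_mul_mul {k d : ℕ} {U : Matrix (Fin k) (Fin k) ℝ} {V : Matrix (Fin d) (Fin d) ℝ}
    (hV : V * Vᵀ = (1 : Matrix (Fin d) (Fin d) ℝ)) (M : Fin k → Fin d → ℝ) (x : Fin k → ℝ) :
    gramForm (U * Matrix.of M * V : Matrix (Fin k) (Fin d) ℝ) x = gramForm M (x ᵥ* U) := by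
  have h : x ᵥ* (U * Matrix.of M * V : Matrix (Fin k) (Fin d) ℝ)
      = ((x ᵥ* U) ᵥ* Matrix.of M) ᵥ* V := by
    rw [vecMul_vecMul, vecMul_vecMul, Matrix.mul_assoc]
  exact (congrArg (fun y => y ⬝ᵥ y) h).trans (vecMul_dotProduct_vecMul_self hV _)

/-- The matrices `M` for which the least or the greatest value of `‖xᵀ M‖²` on the unit sphere
differs from `lo` or `hi`, respectively, by more than `δ` (or by `δ` in the inner direction). -/
def gramDeviation (k d : ℕ) (lo hi δ : ℝ) : Set (Fin k → Fin d → ℝ) :=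
  {M | (∃ x, gramForm M x < (lo - δ) * (x ⬝ᵥ x)) ∨ (∃ x, (hi + δ) * (x ⬝ᵥ x) < gramForm M x) ∨
    (∀ x, (lo + δ) * (x ⬝ᵥ x) ≤ gramForm M x) ∨ ∀ x, gramForm M x ≤ (hi - δ) * (x ⬝ᵥ x)}

lemma measurableSet_gramDeviation (k d : ℕ) (lo hi δ : ℝ) :
    MeasurableSet (gramDeviation k d lo hi δ) := by
  have h1 : IsOpen {M : Fin k → Fin d → ℝ | ∃ x, gramForm M x < (lo - δ) * (x ⬝ᵥ x)} := by
    simp only [Set.ofPred_exists]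
    exact isOpen_iUnion fun x => isOpen_lt (continuous_gramForm x) continuous_const
  have h2 : IsOpen {M : Fin k → Fin d → ℝ | ∃ x, (hi + δ) * (x ⬝ᵥ x) < gramForm M x} := by
    simp only [Set.ofPred_exists]
    exact isOpen_iUnion fun x => isOpen_lt continuous_const (continuous_gramForm x)
  have h3 : IsClosed {M : Fin k → Fin d → ℝ | ∀ x, (lo + δ) * (x ⬝ᵥ x) ≤ gramForm M x} := by
    simp only [Set.ofPred_forall]
    exact isClosed_iInter fun x => isClosed_le continuous_const (continuous_gramForm x)
  have h4 : IsClosed {M : Fin k → Fin d → ℝ | ∀ x, gramForm M x ≤ (hi - δ) * (x ⬝ᵥ x)} := by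
    simp only [Set.ofPred_forall]
    exact isClosed_iInter fun x => isClosed_le (continuous_gramForm x) continuous_const
  exact h1.measurableSet.union (h2.measurableSet.union (h3.measurableSet.union h4.measurableSet))

lemma orthogonalInvariant_gramDeviation (k d : ℕ) (lo hi δ : ℝ) :
    OrthogonalInvariant (gramDeviation k d lo hi δ) := by
  intro U V hU hV _ M hM
  have hV' : V * Vᵀ = (1 : Matrix (Fin d) (Fin d) ℝ) := mul_eq_one_comm.mp hV
  have hU' : U * Uᵀ = (1 : Matrix (Fin k) (Fin k) ℝ) := mul_eq_one_comm.mp hU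
  have hback : ∀ x : Fin k → ℝ, (x ᵥ* Uᵀ) ᵥ* U = x := fun x => by
    rw [vecMul_vecMul, hU, vecMul_one]
  have hnorm : ∀ x : Fin k → ℝ, (x ᵥ* Uᵀ) ⬝ᵥ (x ᵥ* Uᵀ) = x ⬝ᵥ x := fun x =>
    vecMul_dotProduct_vecMul_self (by rwa [transpose_transpose]) x
  rcases hM with ⟨x, hx⟩ | ⟨x, hx⟩ | h | h
  · exact Or.inl ⟨x ᵥ* Uᵀ, by rwa [gramForm_mul_mul hV', hback, hnorm]⟩
  · exact Or.inr (Or.inl ⟨x ᵥ* Uᵀ, by rwa [gramForm_mul_mul hV', hback, hnorm]⟩)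
  · refine Or.inr (Or.inr (Or.inl fun x => ?_))
    rw [gramForm_mul_mul hV', ← vecMul_dotProduct_vecMul_self hU' x]
    exact h _
  · refine Or.inr (Or.inr (Or.inr fun x => ?_))
    rw [gramForm_mul_mul hV', ← vecMul_dotProduct_vecMul_self hU' x]
    exact h _

/-- The extension of a finite sequence by zero. -/
def extendZero {d : ℕ} (x : Fin d → ℝ) : ℕ → ℝ := fun j => if h : j < d then x ⟨j, h⟩ else 0

lemma dotProduct_self_eq_sum_range {d : ℕ} (x : Fin d → ℝ) :
    x ⬝ᵥ x = ∑ j ∈ Finset.range d, extendZero x j ^ 2 := by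
  rw [← Fin.sum_univ_eq_sum_range (fun j => extendZero x j ^ 2) d]
  simp [dotProduct, extendZero, sq]

lemma vecMul_bidiagonal {d k : ℕ} (s : ℕ → ℝ) (x : Fin d → ℝ) (j : Fin k) :
    (x ᵥ* Matrix.of (bidiagonal d k s)) j
      = s (2 * j) * extendZero x j + s (2 * j + 1) * extendZero x (j + 1) := by
  have h : ∀ c : ℕ → ℝ, ∀ m : ℕ, ∑ i : Fin d, (if (i : ℕ) = m then x i * c j else 0)
      = c j * extendZero x m := fun c m => by
    by_cases hm : m < d
    · rw [Finset.sum_eq_single ⟨m, hm⟩]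
      · simp [extendZero, hm, mul_comm]
      · intro i _ hi
        rw [if_neg fun h => hi (Fin.ext h)]
      · simp
    · rw [Finset.sum_eq_zero fun (i : Fin d) _ => if_neg fun h : (i : ℕ) = m => hm (h ▸ i.isLt)]
      simp [extendZero, hm]
  rw [← h (fun j => s (2 * j)), ← h (fun j => s (2 * j + 1)), ← Finset.sum_add_distrib, vecMul,
    dotProduct]
  refine Finset.sum_congr rfl fun i _ => ?_
  change x i * bidiagonal d k s i j = _
  simp only [bidiagonal]
  by_cases h1 : (i : ℕ) = j
  · simp [h1]
  · by_cases h2 : (i : ℕ) = j + 1 <;> simp [h1, h2]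

lemma gramForm_bidiagonal {d k : ℕ} (hdk : d ≤ k) (s : ℕ → ℝ) (x : Fin d → ℝ) :
    gramForm (bidiagonal d k s) x
      = bandForm (fun j => s (2 * j)) (fun j => s (2 * j + 1)) (extendZero x) d := by
  simp only [gramForm, dotProduct, vecMul_bidiagonal]
  rw [Fin.sum_univ_eq_sum_range (fun j => (s (2 * j) * extendZero x j
    + s (2 * j + 1) * extendZero x (j + 1)) * (s (2 * j) * extendZero x j
    + s (2 * j + 1) * extendZero x (j + 1))) k, bandForm]
  symm
  refine (Finset.sum_subset (Finset.range_subset_range.mpr hdk) fun j _ hj => ?_).trans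
    (Finset.sum_congr rfl fun j _ => sq _)
  have : d ≤ j := by simpa using hj
  simp [extendZero, this.not_gt, show ¬ j + 1 < d by omega]

lemma bidiagonal_notMem_gramDeviation {k d n : ℕ} (hn : n < d) (hdk : d ≤ k) {s : ℕ → ℝ}
    {η δ ε lo hi : ℝ} (hη0 : 0 ≤ η) (hη1 : η ≤ 1)
    (ha : ∀ j < d, |s (2 * j) - √(((k : ℝ) - j) / k)| ≤ η)
    (hb : ∀ j < d, |s (2 * j + 1) - √(((d : ℝ) - j) / k)| ≤ η)
    (hε : 8 * √((n : ℝ) / k) + 4 / (n + 1) + 12 * η < ε)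
    (hlo : |(1 - √((d : ℝ) / k)) ^ 2 - lo| ≤ δ - ε)
    (hhi : |(1 + √((d : ℝ) / k)) ^ 2 - hi| ≤ δ - ε) :
    bidiagonal d k s ∉ gramDeviation d k lo hi δ := by
  obtain ⟨hX, h1, h2⟩ := bandForm_bounds hn hdk hη0 hη1 ha hb hε
  rw [abs_le] at hlo hhi
  have hx0 : ∀ x : Fin d → ℝ, 0 ≤ x ⬝ᵥ x := fun x => by
    rw [dotProduct_self_eq_sum_range]; positivity
  have hext : ∀ σ, extendZero (fun i : Fin d => truncPow σ n i) = truncPow σ n := fun σ => by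
    funext j
    by_cases hj : j < d
    · simp [extendZero, hj]
    · simp [extendZero, hj, truncPow, show ¬ j ≤ n by omega]
  have hpos : ∀ σ, 0 ≤ ∑ j ∈ Finset.range d, truncPow σ n j ^ 2 := fun σ => by positivity
  rintro (⟨x, hx⟩ | ⟨x, hx⟩ | h | h)
  · rw [gramForm_bidiagonal hdk] at hx
    have := (hX (extendZero x) (by simp [extendZero])).1
    rw [← dotProduct_self_eq_sum_range] at this
    nlinarith [mul_le_mul_of_nonneg_right
      (show lo - δ ≤ (1 - √((d : ℝ) / k)) ^ 2 - ε by linarith) (hx0 x)]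
  · rw [gramForm_bidiagonal hdk] at hx
    have := (hX (extendZero x) (by simp [extendZero])).2
    rw [← dotProduct_self_eq_sum_range] at this
    nlinarith [mul_le_mul_of_nonneg_right
      (show (1 + √((d : ℝ) / k)) ^ 2 + ε ≤ hi + δ by linarith) (hx0 x)]
  · have := h (fun i => truncPow (-1) n i)
    rw [gramForm_bidiagonal hdk, dotProduct_self_eq_sum_range, hext] at this
    nlinarith [mul_le_mul_of_nonneg_right
      (show (1 - √((d : ℝ) / k)) ^ 2 + ε ≤ lo + δ by linarith) (hpos (-1))]
  · have := h (fun i => truncPow 1 n i)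
    rw [gramForm_bidiagonal hdk, dotProduct_self_eq_sum_range, hext] at this
    nlinarith [mul_le_mul_of_nonneg_right
      (show hi - δ ≤ (1 + √((d : ℝ) / k)) ^ 2 - ε by linarith) (hpos 1)]

lemma dotProduct_self_nonneg_real {n : ℕ} (x : Fin n → ℝ) : 0 ≤ x ⬝ᵥ x :=
  Finset.sum_nonneg fun _ _ => mul_self_nonneg _

lemma mem_spectrum_iff_exists_mulVec {n : ℕ} (M : Matrix (Fin n) (Fin n) ℝ) (c : ℝ) :
    c ∈ spectrum ℝ M ↔ ∃ x ≠ 0, M *ᵥ x = c • x := by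
  rw [spectrum.mem_iff, Matrix.isUnit_iff_isUnit_det, isUnit_iff_ne_zero, not_not,
    ← Matrix.exists_mulVec_eq_zero_iff]
  refine exists_congr fun x => and_congr_right fun _ => ?_
  rw [sub_mulVec, Algebra.algebraMap_eq_smul_one, smul_mulVec, one_mulVec, sub_eq_zero, eq_comm]

lemma mul_le_quadraticForm_of_spectrum {n : ℕ} {M : Matrix (Fin n) (Fin n) ℝ} (hM : M.IsHermitian)
    {c : ℝ} (h : ∀ l ∈ spectrum ℝ M, c ≤ l) (x : Fin n → ℝ) :
    c * (x ⬝ᵥ x) ≤ x ⬝ᵥ (M *ᵥ x) := by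
  have hH : (M - c • (1 : Matrix (Fin n) (Fin n) ℝ)).IsHermitian :=
    hM.sub (by simp [IsHermitian])
  have hps : (M - c • (1 : Matrix (Fin n) (Fin n) ℝ)).PosSemidef := by
    refine hH.posSemidef_iff_eigenvalues_nonneg.mpr fun i => ?_
    obtain ⟨y, hy0, hy⟩ :=
      (mem_spectrum_iff_exists_mulVec _ _).mp (hH.eigenvalues_mem_spectrum_real i)
    have := h (hH.eigenvalues i + c) ((mem_spectrum_iff_exists_mulVec _ _).mpr ⟨y, hy0, by
      rw [sub_mulVec, smul_mulVec, one_mulVec, sub_eq_iff_eq_add] at hy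
      rw [hy, add_smul]⟩)
    simpa using this
  have := hps.dotProduct_mulVec_nonneg x
  rw [sub_mulVec, smul_mulVec, one_mulVec, dotProduct_sub, dotProduct_smul] at this
  simpa using this

lemma quadraticForm_le_mul_of_spectrum {n : ℕ} {M : Matrix (Fin n) (Fin n) ℝ} (hM : M.IsHermitian)
    {c : ℝ} (h : ∀ l ∈ spectrum ℝ M, l ≤ c) (x : Fin n → ℝ) :
    x ⬝ᵥ (M *ᵥ x) ≤ c * (x ⬝ᵥ x) := by
  have := mul_le_quadraticForm_of_spectrum hM.neg (c := -c) (fun l hl => by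
    rw [mem_spectrum_iff_exists_mulVec] at hl
    obtain ⟨y, hy0, hy⟩ := hl
    have := h (-l) ((mem_spectrum_iff_exists_mulVec _ _).mpr ⟨y, hy0, by
      rw [neg_smul, ← hy, neg_mulVec, neg_neg]⟩)
    linarith) x
  rw [neg_mulVec, dotProduct_neg] at this
  linarith

lemma abs_extremeEigenvalues_sub_le {n : ℕ} (hn : 0 < n) {M : Matrix (Fin n) (Fin n) ℝ}
    (hM : M.IsHermitian) {lo hi δ : ℝ}
    (h1 : ∀ x : Fin n → ℝ, (lo - δ) * (x ⬝ᵥ x) ≤ x ⬝ᵥ (M *ᵥ x))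
    (h2 : ∀ x : Fin n → ℝ, x ⬝ᵥ (M *ᵥ x) ≤ (hi + δ) * (x ⬝ᵥ x))
    (h3 : ∃ x : Fin n → ℝ, x ⬝ᵥ (M *ᵥ x) < (lo + δ) * (x ⬝ᵥ x))
    (h4 : ∃ x : Fin n → ℝ, (hi - δ) * (x ⬝ᵥ x) < x ⬝ᵥ (M *ᵥ x)) :
    |lambdaMin M - lo| ≤ δ ∧ |lambdaMax M - hi| ≤ δ := by
  have : Nonempty (Fin n) := ⟨⟨0, hn⟩⟩
  have hfin : (spectrum ℝ M).Finite := by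
    rw [hM.spectrum_real_eq_range_eigenvalues]; exact Set.finite_range _
  have hne : (spectrum ℝ M).Nonempty := by
    rw [hM.spectrum_real_eq_range_eigenvalues]; exact Set.range_nonempty _
  have hmem : ∀ l ∈ spectrum ℝ M, ∃ x : Fin n → ℝ, 0 < x ⬝ᵥ x ∧ x ⬝ᵥ (M *ᵥ x) = l * (x ⬝ᵥ x) := by
    intro l hl
    obtain ⟨x, hx0, hx⟩ := (mem_spectrum_iff_exists_mulVec _ _).mp hl
    refine ⟨x, lt_of_le_of_ne (dotProduct_self_nonneg_real x) fun h =>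
      hx0 (dotProduct_self_eq_zero.mp h.symm), ?_⟩
    rw [hx, dotProduct_smul, smul_eq_mul]
  have hmin := hne.csInf_mem hfin
  have hmax := hne.csSup_mem hfin
  rw [abs_le, abs_le]
  unfold lambdaMin lambdaMax
  refine ⟨⟨?_, ?_⟩, ?_, ?_⟩
  · obtain ⟨x, hx0, hx⟩ := hmem _ hmin
    have := le_of_mul_le_mul_right ((h1 x).trans_eq hx) hx0
    linarith
  · obtain ⟨x, hx⟩ := h3
    have := (mul_le_quadraticForm_of_spectrum hM
      (fun l hl => csInf_le hfin.bddBelow hl) x).trans_lt hx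
    have := lt_of_mul_lt_mul_right this (dotProduct_self_nonneg_real x)
    linarith
  · obtain ⟨x, hx⟩ := h4
    have := hx.trans_le (quadraticForm_le_mul_of_spectrum hM
      (fun l hl => le_csSup hfin.bddAbove hl) x)
    have := lt_of_mul_lt_mul_right this (dotProduct_self_nonneg_real x)
    linarith
  · obtain ⟨x, hx0, hx⟩ := hmem _ hmax
    have := le_of_mul_le_mul_right (hx.symm.trans_le (h2 x)) hx0
    linarith

lemma abs_sub_sqrt_le {a b η : ℝ} (ha : 0 ≤ a) (hb : 0 ≤ b) (h : |a ^ 2 - b| ≤ η) :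
    |a - √b| ≤ √η := by
  refine Real.abs_le_sqrt (le_trans ?_ h)
  have hs := Real.sq_sqrt hb
  have hs0 := Real.sqrt_nonneg b
  rw [le_abs]
  rcases le_total (√b) a with hab | hab
  · left; nlinarith
  · right; nlinarith

lemma gaussianArray_gramDeviation_le {k d n : ℕ} (hn : n < d) (hdk : d ≤ k) {ε τ δ lo hi : ℝ}
    (hε : 0 < ε) (hε1 : √(ε + 1 / k) ≤ 1)
    (hτ : 8 * √((n : ℝ) / k) + 4 / (n + 1) + 12 * √(ε + 1 / k) < τ)
    (hlo : |(1 - √((d : ℝ) / k)) ^ 2 - lo| ≤ δ - τ)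
    (hhi : |(1 + √((d : ℝ) / k)) ^ 2 - hi| ≤ δ - τ) :
    gaussianArray (1 / k) d k (gramDeviation d k lo hi δ)
      ≤ (d + k : ℕ) * ENNReal.ofReal (2 * Real.exp (-(ε ^ 2 * k / 8))) := by
  have hk : (0 : ℝ) < k := by exact_mod_cast (Nat.zero_le n).trans_lt (hn.trans_le hdk)
  have hk' : (k : ℝ≥0) ≠ 0 := by exact_mod_cast hk.ne'
  have hv : ((1 / k : ℝ≥0) : ℝ) = 1 / k := by simp
  have hεle : ε ≤ 1 := by
    rw [Real.sqrt_le_one] at hε1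
    have : (0 : ℝ) ≤ 1 / k := by positivity
    linarith
  have hdk' : (d : ℝ) ≤ k := by exact_mod_cast hdk
  refine gaussianArray_le_of_bidiagonal (1 / k)
    (T := fun l => {c | 0 ≤ c ∧ |c ^ 2 - l * (1 / k)| ≤ ε}) (fun l => ?_) (fun l => ?_)
    (N := k) (fun l hl => ?_) d k hdk le_rfl _ (measurableSet_gramDeviation d k lo hi δ)
    (orthogonalInvariant_gramDeviation d k lo hi δ) fun s hs1 hs2 => ?_
  · exact ((isClosed_le continuous_const continuous_id).inter (isClosed_le
      (by fun_prop : Continuous fun c : ℝ => |c ^ 2 - l * (1 / k)|) continuous_const)).measurableSet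
  · refine ⟨√(l * (1 / k)), Real.sqrt_nonneg _, ?_⟩
    rw [Real.sq_sqrt (by positivity), sub_self, abs_zero]
    exact hε.le
  · have hc := gaussianVector_norm_concentration (v := 1 / k) (by simpa using hk') (n := l)
      (by rw [hv, mul_one_div, div_le_one hk]; exact_mod_cast hl) hε hεle
    have hset : {r : Fin l → ℝ | √(r ⬝ᵥ r) ∉ {c : ℝ | 0 ≤ c ∧ |c ^ 2 - l * (1 / k)| ≤ ε}}
        = {r | ε < |r ⬝ᵥ r - l * ((1 / k : ℝ≥0) : ℝ)|} := by
      ext r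
      have hr : 0 ≤ r ⬝ᵥ r := dotProduct_self_nonneg_real r
      simp only [Set.mem_ofPred_eq, Real.sqrt_nonneg, true_and, not_le, Real.sq_sqrt hr, hv]
    rw [hset, ← ofReal_measureReal]
    refine ENNReal.ofReal_le_ofReal (hc.trans_eq ?_)
    rw [hv]
    congr 3
    field_simp
  · refine bidiagonal_notMem_gramDeviation hn hdk (Real.sqrt_nonneg _) hε1 (fun j hj => ?_)
      (fun j hj => ?_) hτ hlo hhi
    · have hjk : (j : ℝ) ≤ k := by exact_mod_cast (hj.trans_le hdk).le
      refine (abs_sub_sqrt_le (hs1 j).1 (div_nonneg (by linarith) hk.le) ?_).trans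
        (Real.sqrt_le_sqrt (le_add_of_nonneg_right (by positivity : (0 : ℝ) ≤ 1 / k)))
      have := (hs1 j).2
      rwa [Nat.cast_sub (hj.trans_le hdk).le, mul_one_div] at this
    · have hjd : (j : ℝ) ≤ d := by exact_mod_cast hj.le
      refine abs_sub_sqrt_le (hs2 j).1 (div_nonneg (by linarith) hk.le) ?_
      have := (hs2 j).2
      rw [Nat.cast_sub (by omega), Nat.cast_sub (by omega), Nat.cast_one] at this
      have hk1 : (0 : ℝ) ≤ 1 / k := by positivity
      have he : s (2 * j + 1) ^ 2 - ((d : ℝ) - j) / k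
          = s (2 * j + 1) ^ 2 - (d - 1 - j) * (1 / k) - 1 / k := by ring
      rw [he]
      refine (abs_sub _ _).trans ?_
      rw [abs_of_nonneg hk1]
      linarith

lemma gramForm_transpose {k d : ℕ} (G : Matrix (Fin k) (Fin d) ℝ) (x : Fin d → ℝ) :
    gramForm (fun i j => G j i) x = x ⬝ᵥ ((Gᵀ * G) *ᵥ x) := by
  change (x ᵥ* Gᵀ) ⬝ᵥ (x ᵥ* Gᵀ) = _
  rw [vecMul_transpose, ← mulVec_mulVec, mulVec_transpose, dotProduct_comm x, ← dotProduct_mulVec]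

lemma gaussianMatrix_extremeEigenvalues_le {k d : ℕ} (hd : 0 < d) {α δ : ℝ} (hα0 : 0 ≤ α)
    (hα1 : α ≤ 1) :
    gaussianMatrix k d {G | δ < max (|(|1 - lambdaMin (Gᵀ * G)|) - (2 * √α - α)|)
        (|(|1 - lambdaMax (Gᵀ * G)|) - (2 * √α + α)|)}
      ≤ gaussianArray (1 / k) d k (gramDeviation d k ((1 - √α) ^ 2) ((1 + √α) ^ 2) δ) := by
  rw [← (measurePreserving_swap_gaussianArray (1 / k) k d).measure_preimage
    (measurableSet_gramDeviation d k _ _ δ).nullMeasurableSet]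
  refine measure_mono (μ := gaussianArray (1 / k) k d) fun G hG => ?_
  by_contra hmem
  replace hG : δ < max (|(|1 - lambdaMin ((Matrix.of G)ᵀ * Matrix.of G)|) - (2 * √α - α)|)
      (|(|1 - lambdaMax ((Matrix.of G)ᵀ * Matrix.of G)|) - (2 * √α + α)|) := hG
  refine absurd hG (not_lt.mpr ?_)
  change ¬ (_ ∨ _ ∨ _ ∨ _) at hmem
  push Not at hmem
  obtain ⟨h1, h2, h3, h4⟩ := hmem
  have hq := gramForm_transpose (Matrix.of G)
  simp only [Matrix.of_apply] at hq
  simp only [hq] at h1 h2 h3 h4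
  obtain ⟨hlo, hhi⟩ := abs_extremeEigenvalues_sub_le hd
    (isHermitian_conjTranspose_mul_self (Matrix.of G)) h1 h2 h3 h4
  have hs := Real.sq_sqrt hα0
  have hs0 := Real.sqrt_nonneg α
  have hs1 : √α ≤ 1 := Real.sqrt_le_one.mpr hα1
  have hminus : 2 * √α - α = |1 - (1 - √α) ^ 2| := by
    rw [abs_of_nonneg (by nlinarith)]; linarith
  have hplus : 2 * √α + α = |1 - (1 + √α) ^ 2| := by
    rw [abs_of_nonpos (by nlinarith)]; linarith
  rw [hminus, hplus]
  refine max_le ((abs_abs_sub_abs_le_abs_sub _ _).trans ?_)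
    ((abs_abs_sub_abs_le_abs_sub _ _).trans ?_)
  · rw [sub_sub_sub_cancel_left, abs_sub_comm]; exact hlo
  · rw [sub_sub_sub_cancel_left, abs_sub_comm]; exact hhi

lemma tendsto_mul_exp_neg_mul {c : ℝ} (hc : 0 < c) :
    Tendsto (fun x : ℝ => x * Real.exp (-(c * x))) atTop (nhds 0) := by
  have h := ((Real.tendsto_pow_mul_exp_neg_atTop_nhds_zero 1).comp
    (tendsto_id.const_mul_atTop hc)).const_mul c⁻¹
  rw [mul_zero] at h
  refine h.congr fun x => ?_
  simp only [Function.comp_apply, id, pow_one]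
  field_simp

/-- For Wishart matrices `Gᵀ G` with `G` a `k_m × d_m` matrix of independent
`N(0, 1/k_m)` entries, `d_m ≤ k_m`, `d_m, k_m → ∞` and `d_m / k_m → α ∈ (0, 1]`, the
random vector `(|1 − λ_min(Gᵀ G)|, |1 − λ_max(Gᵀ G)|)` converges in probability (in the
sup-norm on `ℝ²`) to the constant vector `(2√α − α, 2√α + α)`. -/
theorem abs_one_sub_eigenvalues_wishart_tendsto
    (k d : ℕ → ℕ) (α : ℝ) (hα0 : 0 < α) (hα1 : α ≤ 1)
    (hdk : ∀ m, d m ≤ k m)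
    (htd : Tendsto (fun m => d m) atTop atTop)
    (htk : Tendsto (fun m => k m) atTop atTop)
    (hratio : Tendsto (fun m => (d m : ℝ) / (k m : ℝ)) atTop (nhds α)) :
    ∀ δ : ℝ, 0 < δ →
      Tendsto
        (fun m => gaussianMatrix (k m) (d m)
          {G | δ < max
              (|(|1 - lambdaMin (Gᵀ * G)|) - (2 * Real.sqrt α - α)|)
              (|(|1 - lambdaMax (Gᵀ * G)|) - (2 * Real.sqrt α + α)|)})
        atTop (nhds 0) := by
  intro δ hδ
  obtain ⟨n, hn⟩ : ∃ n : ℕ, 4 / ((n : ℝ) + 1) < δ / 8 := by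
    obtain ⟨n, hn⟩ := exists_nat_gt (32 / δ)
    refine ⟨n, ?_⟩
    rw [div_lt_iff₀ hδ] at hn
    rw [div_lt_iff₀ (by positivity)]
    linarith
  set ρ := min 1 δ / 100 with hρ
  have hρ0 : 0 < ρ := by positivity
  have hρ1 : ρ < 1 := by have := min_le_left 1 δ; linarith
  have hρδ : ρ ≤ δ / 100 := by have := min_le_right 1 δ; linarith
  have hkR : Tendsto (fun m => (k m : ℝ)) atTop atTop := tendsto_natCast_atTop_atTop.comp htk
  have hη : Tendsto (fun m => √(ρ ^ 2 + 1 / (k m : ℝ))) atTop (nhds ρ) := by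
    have := ((hkR.const_div_atTop 1).const_add (ρ ^ 2)).sqrt
    rwa [add_zero, Real.sqrt_sq hρ0.le] at this
  have hτ : Tendsto (fun m => 8 * √((n : ℝ) / k m) + 4 / (n + 1) + 12 * √(ρ ^ 2 + 1 / (k m : ℝ)))
      atTop (nhds (4 / ((n : ℝ) + 1) + 12 * ρ)) := by
    have := ((((hkR.const_div_atTop (n : ℝ)).sqrt.const_mul 8).add_const
      (4 / ((n : ℝ) + 1))).add (hη.const_mul 12))
    rwa [Real.sqrt_zero, mul_zero, zero_add] at this
  have hdrift : ∀ σ : ℝ, ∀ᶠ m in atTop,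
      |(1 + σ * √((d m : ℝ) / k m)) ^ 2 - (1 + σ * √α) ^ 2| ≤ δ - δ / 2 := fun σ => by
    have := (((hratio.sqrt.const_mul σ).const_add 1).pow 2).sub_const ((1 + σ * √α) ^ 2)
    rw [sub_self] at this
    have h := this.abs
    rw [abs_zero] at h
    exact (h.eventually_lt_const (by linarith : (0 : ℝ) < δ - δ / 2)).mono fun m hm => hm.le
  have hlim : Tendsto (fun m => ENNReal.ofReal
      (4 * ((k m : ℝ) * Real.exp (-((ρ ^ 2) ^ 2 / 8 * k m))))) atTop (nhds 0) := by
    have := ENNReal.tendsto_ofReal (((tendsto_mul_exp_neg_mul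
      (by positivity : 0 < (ρ ^ 2) ^ 2 / 8)).comp hkR).const_mul 4)
    rwa [mul_zero, ENNReal.ofReal_zero] at this
  refine tendsto_of_tendsto_of_tendsto_of_le_of_le' tendsto_const_nhds hlim
    (Eventually.of_forall fun _ => zero_le) ?_
  filter_upwards [htd.eventually_gt_atTop n, hη.eventually_lt_const hρ1,
    hτ.eventually_lt_const (by linarith : _ < δ / 2), hdrift (-1), hdrift 1] with m h1 h2 h3 h4 h5
  rw [neg_one_mul, neg_one_mul, ← sub_eq_add_neg, ← sub_eq_add_neg] at h4
  rw [one_mul, one_mul] at h5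
  refine (gaussianMatrix_extremeEigenvalues_le ((Nat.zero_le n).trans_lt h1) hα0.le hα1).trans
    ((gaussianArray_gramDeviation_le h1 (hdk m) (by positivity) h2.le h3 h4 h5).trans ?_)
  rw [← ENNReal.ofReal_natCast, ← ENNReal.ofReal_mul (by positivity)]
  refine ENNReal.ofReal_le_ofReal ?_
  have hd' : (d m : ℝ) ≤ k m := by exact_mod_cast hdk m
  rw [Nat.cast_add, mul_div_right_comm]
  nlinarith [mul_le_mul_of_nonneg_right hd' (Real.exp_pos (-((ρ ^ 2) ^ 2 / 8 * k m))).le]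
end

section
/- For each m, let G_m be a k_m × d_m random matrix whose entries are independent N(0, 1/k_m) random variables, where d_m ≤ k_m, d_m → ∞, k_m → ∞, and d_m/k_m → α with α ∈ (0, 1]. Then the largest singular value σ_max(I_{d_m} − G_mᵀG_m) converges in probability to (1 + √α)² − 1. -/
open MeasureTheory ProbabilityTheory Matrix Filter
open scoped ENNReal NNReal

/-- The largest singular value of a rectangular real matrix: the square root of the
largest eigenvalue of `Nᵀ N`. -/
noncomputable def sigmaMax {a b : ℕ} (N : Matrix (Fin a) (Fin b) ℝ) : ℝ :=
  Real.sqrt (lambdaMax (Nᵀ * N))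

/-- A vector of `n` independent `N(0, v)` variables. -/
noncomputable abbrev gaussianVec (v : ℝ≥0) (n : ℕ) : Measure (Fin n → ℝ) :=
  Measure.pi fun _ => gaussianReal 0 v

/-- A `k × n` matrix of independent `N(0, v)` variables. -/
noncomputable def gaussianMat (v : ℝ≥0) (k n : ℕ) : Measure (Matrix (Fin k) (Fin n) ℝ) :=
  Measure.pi fun _ : Fin k => gaussianVec v n

instance (v : ℝ≥0) (k n : ℕ) : IsProbabilityMeasure (gaussianMat v k n) :=
  inferInstanceAs (IsProbabilityMeasure (Measure.pi fun _ : Fin k => gaussianVec v n))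

theorem charFun_gaussianVec (v : ℝ≥0) (n : ℕ) (t : EuclideanSpace ℝ (Fin n)) :
    charFun ((gaussianVec v n).map (WithLp.toLp 2)) t = Complex.exp (-(v * ‖t‖ ^ 2 / 2)) := by
  simp_rw [charFun_pi, charFun_gaussianReal, ← Complex.exp_sum, ← Complex.ofReal_pow,
    EuclideanSpace.real_norm_sq_eq]
  congr 1
  simp [Finset.mul_sum, Finset.sum_div]

/-- Centered isotropic Gaussian vectors are invariant under linear isometries. -/
theorem measurePreserving_mulVec_gaussianVec (v : ℝ≥0) {n : ℕ} {U : Matrix (Fin n) (Fin n) ℝ}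
    (hU : U * Uᵀ = 1) :
    MeasurePreserving (fun x => U *ᵥ x) (gaussianVec v n) (gaussianVec v n) := by
  have hm : Measurable (fun x : Fin n → ℝ => U *ᵥ x) := by fun_prop
  refine ⟨hm, ?_⟩
  have hinj : Function.Injective
      (Measure.map (WithLp.toLp 2) : Measure (Fin n → ℝ) → Measure (EuclideanSpace ℝ (Fin n))) := by
    intro μ ν h
    have := congrArg (Measure.map (WithLp.ofLp)) h
    rwa [Measure.map_map (by fun_prop) (by fun_prop), Measure.map_map (by fun_prop) (by fun_prop),
      show (WithLp.ofLp ∘ WithLp.toLp 2 : (Fin n → ℝ) → (Fin n → ℝ)) = id from rfl,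
      Measure.map_id, Measure.map_id] at this
  apply hinj
  apply Measure.ext_of_charFun
  ext t
  rw [charFun_gaussianVec]
  have key : charFun (((gaussianVec v n).map (fun x => U *ᵥ x)).map (WithLp.toLp 2)) t =
      charFun ((gaussianVec v n).map (WithLp.toLp 2)) (WithLp.toLp 2 (Uᵀ *ᵥ t.ofLp)) := by
    rw [charFun_apply, charFun_apply, Measure.map_map (by fun_prop) hm,
      integral_map (by fun_prop) (by fun_prop), integral_map (by fun_prop) (by fun_prop)]
    congr 1
    ext x
    congr 3
    simp only [Function.comp, EuclideanSpace.inner_eq_star_dotProduct, star_trivial]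
    rw [Matrix.mulVec_transpose, Matrix.dotProduct_mulVec]
  rw [key, charFun_gaussianVec]
  congr 4
  rw [← Complex.ofReal_pow, ← Complex.ofReal_pow, EuclideanSpace.real_norm_sq_eq,
    EuclideanSpace.real_norm_sq_eq]
  have : (Uᵀ *ᵥ t.ofLp) ⬝ᵥ (Uᵀ *ᵥ t.ofLp) = t.ofLp ⬝ᵥ t.ofLp := by
    rw [Matrix.dotProduct_mulVec, Matrix.vecMul_transpose, Matrix.mulVec_mulVec, hU,
      Matrix.one_mulVec]
  simpa [dotProduct, sq] using congrArg (fun r : ℝ => (r : ℂ)) this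

/-- The matrix with first column `c` and remaining columns `H`. -/
def consCol {k n : ℕ} (c : Fin k → ℝ) (H : Matrix (Fin k) (Fin n) ℝ) :
    Matrix (Fin k) (Fin (n + 1)) ℝ :=
  fun i => Fin.cons (c i) (H i)

/-- The matrix with first row `g` and remaining rows `H`. -/
def consRow {k n : ℕ} (g : Fin n → ℝ) (H : Matrix (Fin k) (Fin n) ℝ) :
    Matrix (Fin (k + 1)) (Fin n) ℝ :=
  Fin.cons (α := fun _ => Fin n → ℝ) g H

theorem measurePreserving_finCons {β : Type*} [MeasurableSpace β] (μ : Measure β) [SigmaFinite μ]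
    (n : ℕ) :
    MeasurePreserving (fun p : β × (Fin n → β) => (Fin.cons p.1 p.2 : Fin (n + 1) → β))
      (μ.prod (Measure.pi fun _ => μ)) (Measure.pi fun _ => μ) := by
  have h := (measurePreserving_piFinSuccAbove (fun _ : Fin (n + 1) => μ) 0).symm
  convert h using 1
  ext p i
  simp [MeasurableEquiv.piFinSuccAbove, Fin.insertNthEquiv]

theorem measurePreserving_consRow (v : ℝ≥0) (k n : ℕ) :
    MeasurePreserving (fun p : (Fin n → ℝ) × Matrix (Fin k) (Fin n) ℝ => consRow p.1 p.2)
      ((gaussianVec v n).prod (gaussianMat v k n)) (gaussianMat v (k + 1) n) :=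
  measurePreserving_finCons (gaussianVec v n) k

theorem measurePreserving_consCol (v : ℝ≥0) (k n : ℕ) :
    MeasurePreserving (fun p : (Fin k → ℝ) × Matrix (Fin k) (Fin n) ℝ => consCol p.1 p.2)
      ((gaussianVec v k).prod (gaussianMat v k n)) (gaussianMat v k (n + 1)) := by
  have h1 := (measurePreserving_arrowProdEquivProdArrow ℝ (Fin n → ℝ) (Fin k)
    (fun _ => gaussianReal 0 v) (fun _ => gaussianVec v n)).symm
  have h2 := measurePreserving_pi
    (fun _ : Fin k => (gaussianReal 0 v).prod (gaussianVec v n)) (fun _ => gaussianVec v (n + 1))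
    (fun _ => measurePreserving_finCons (gaussianReal 0 v) n)
  exact h2.comp h1

theorem mul_consCol {k n : ℕ} (U : Matrix (Fin k) (Fin k) ℝ) (c : Fin k → ℝ)
    (H : Matrix (Fin k) (Fin n) ℝ) : U * consCol c H = consCol (U *ᵥ c) (U * H) := by
  ext i j
  refine Fin.cases ?_ (fun j => ?_) j <;>
    simp [consCol, Matrix.mul_apply, Matrix.mulVec, dotProduct]

theorem measurePreserving_mul_left_gaussianMat (v : ℝ≥0) {k : ℕ} (n : ℕ)
    {U : Matrix (Fin k) (Fin k) ℝ} (hU : U * Uᵀ = 1) :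
    MeasurePreserving (fun G => U * G) (gaussianMat v k n) (gaussianMat v k n) := by
  induction n with
  | zero =>
    have : (fun G : Matrix (Fin k) (Fin 0) ℝ => U * G) = id := by
      ext G i j; exact j.elim0
    rw [this]
    exact MeasurePreserving.id _
  | succ n ih =>
    have hc := measurePreserving_consCol v k n
    have hp := hc.comp ((measurePreserving_mulVec_gaussianVec v hU).prod ih)
    have hm : Measurable (fun G : Matrix (Fin k) (Fin (n + 1)) ℝ => U * G) := by
      refine measurable_pi_lambda _ fun i => measurable_pi_lambda _ fun j => ?_
      simp only [Matrix.mul_apply]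
      refine Finset.measurable_sum _ fun l _ => Measurable.const_mul ?_ _
      exact (measurable_pi_apply j).comp (measurable_pi_apply l)
    refine ⟨hm, ?_⟩
    conv_lhs => rw [← hc.map_eq]
    rw [Measure.map_map hm hc.measurable]
    convert hp.map_eq using 2
    ext1 p
    exact mul_consCol U p.1 p.2

theorem measurePreserving_mul_right_gaussianMat (v : ℝ≥0) (k : ℕ) {n : ℕ}
    {V : Matrix (Fin n) (Fin n) ℝ} (hV : Vᵀ * V = 1) :
    MeasurePreserving (fun G => G * V) (gaussianMat v k n) (gaussianMat v k n) := by
  have h := measurePreserving_pi (fun _ : Fin k => gaussianVec v n) (fun _ => gaussianVec v n)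
    (fun _ => measurePreserving_mulVec_gaussianVec v (U := Vᵀ) (by simpa using hV))
  have he : (fun (G : Fin k → Fin n → ℝ) i => Vᵀ *ᵥ G i) = fun G => (G : Matrix _ _ ℝ) * V := by
    ext G i j
    change ∑ l, V l j * G i l = ∑ l, G i l * V l j
    simp only [mul_comm]
  rw [he] at h
  exact h

/-- Any vector is rotated to a multiple of the first basis vector by an orthogonal matrix. -/
theorem exists_orthogonal_mulVec_eq_single {n : ℕ} (c : Fin (n + 1) → ℝ) :
    ∃ U : Matrix (Fin (n + 1)) (Fin (n + 1)) ℝ, U * Uᵀ = 1 ∧ Uᵀ * U = 1 ∧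
      U *ᵥ c = Pi.single 0 (Real.sqrt (c ⬝ᵥ c)) := by
  set r := Real.sqrt (c ⬝ᵥ c) with hr
  set w : Fin (n + 1) → ℝ := c - Pi.single 0 r with hw
  have hcc : 0 ≤ c ⬝ᵥ c := Finset.sum_nonneg fun i _ => mul_self_nonneg _
  have hr2 : r * r = c ⬝ᵥ c := Real.mul_self_sqrt hcc
  by_cases hw0 : w = 0
  · exact ⟨1, by simp, by simp, by simpa [hw, sub_eq_zero] using hw0⟩
  have hww : w ⬝ᵥ w ≠ 0 := by simpa [dotProduct_self_eq_zero] using hw0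
  have hwc : 2 * (w ⬝ᵥ c) = w ⬝ᵥ w := by
    simp only [hw, sub_dotProduct, dotProduct_sub, single_dotProduct, dotProduct_single,
      Pi.sub_apply, Pi.single_eq_same]
    linear_combination -hr2
  set U : Matrix (Fin (n + 1)) (Fin (n + 1)) ℝ := 1 - (2 / (w ⬝ᵥ w)) • vecMulVec w w with hU
  have hT : Uᵀ = U := by
    simp [hU, transpose_vecMulVec]
  have hUU : U * U = 1 := by
    have h1 : vecMulVec w w * vecMulVec w w = (w ⬝ᵥ w) • vecMulVec w w := by
      rw [vecMulVec_mul_vecMulVec, vecMulVec_smul]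
    simp only [hU, sub_mul, mul_sub, one_mul, mul_one, smul_mul_assoc, mul_smul_comm, h1,
      smul_smul]
    rw [div_mul_cancel₀ _ hww]
    module
  refine ⟨U, by rw [hT, hUU], by rw [hT, hUU], ?_⟩
  have h2 : U *ᵥ c = c - ((2 / (w ⬝ᵥ w)) * (w ⬝ᵥ c)) • w := by
    simp only [hU, sub_mulVec, one_mulVec, smul_mulVec, vecMulVec_mulVec, mul_smul]
    simp
  rw [h2, div_mul_eq_mul_div, hwc, div_self hww, one_smul, hw]
  abel

theorem prod_apply_le_add {β γ : Type*} [MeasurableSpace β] [MeasurableSpace γ]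
    (μ : Measure β) (ν : Measure γ) [IsProbabilityMeasure μ] [IsProbabilityMeasure ν]
    {E : Set (β × γ)} (hE : MeasurableSet E) {A : Set β} (hA : MeasurableSet A) (C : ℝ≥0∞)
    (h : ∀ a ∈ A, ν {b | (a, b) ∈ E} ≤ C) : μ.prod ν E ≤ μ Aᶜ + C := by
  rw [Measure.prod_apply hE]
  calc ∫⁻ a, ν (Prod.mk a ⁻¹' E) ∂μ ≤ ∫⁻ a, (Aᶜ.indicator 1 a + C) ∂μ := by
        refine lintegral_mono fun a => ?_
        by_cases ha : a ∈ A
        · exact (h a ha).trans le_add_self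
        · simp only [Set.indicator_of_mem (Set.mem_compl ha), Pi.one_apply]
          exact prob_le_one.trans le_self_add
    _ = μ Aᶜ + C := by
        rw [lintegral_add_right _ measurable_const, lintegral_indicator_one hA.compl]
        simp

/-- Rotating the first column and then removing the first row and column of a Gaussian matrix. -/
theorem gaussianMat_le_of_peel (v : ℝ≥0) {k n : ℕ}
    {B : Set (Matrix (Fin (k + 1)) (Fin (n + 1)) ℝ)} (hB : MeasurableSet B)
    {I J : Set ℝ} (hI : MeasurableSet I) (hJ : MeasurableSet J)
    (hrot : ∀ U : Matrix (Fin (k + 1)) (Fin (k + 1)) ℝ, Uᵀ * U = 1 → ∀ G ∈ B, U * G ∈ B)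
    (C : ℝ≥0∞)
    (hstep : ∀ r ≥ 0, r * r ∈ I → ∀ g : Fin n → ℝ, g ⬝ᵥ g ∈ J →
      gaussianMat v k n {H | consCol (Pi.single 0 r) (consRow g H) ∈ B} ≤ C) :
    gaussianMat v (k + 1) (n + 1) B ≤
      gaussianVec v (k + 1) {c | c ⬝ᵥ c ∉ I} + (gaussianVec v n {g | g ⬝ᵥ g ∉ J} + C) := by
  have hdot : ∀ n : ℕ, Measurable fun c : Fin n → ℝ => c ⬝ᵥ c := fun n => by
    unfold dotProduct; fun_prop
  have hcol := measurePreserving_consCol v (k + 1) n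
  rw [← hcol.measure_preimage hB.nullMeasurableSet]
  refine prod_apply_le_add _ _ (hcol.measurable hB) (hdot _ hI) _ fun c hc => ?_
  obtain ⟨U, hU1, hU2, hUc⟩ := exists_orthogonal_mulVec_eq_single c
  have hcc : 0 ≤ c ⬝ᵥ c := Finset.sum_nonneg fun i _ => mul_self_nonneg _
  set r := Real.sqrt (c ⬝ᵥ c) with hr
  have hrI : r * r ∈ I := by rw [Real.mul_self_sqrt hcc]; exact hc
  set D : Set (Matrix (Fin (k + 1)) (Fin n) ℝ) := {H | consCol (Pi.single 0 r) H ∈ B} with hD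
  have hDm : MeasurableSet D :=
    (hcol.measurable.comp (measurable_const.prodMk measurable_id)) hB
  have h1 : gaussianMat v (k + 1) n {H | consCol c H ∈ B} ≤ gaussianMat v (k + 1) n D := by
    rw [← (measurePreserving_mul_left_gaussianMat v n hU1).measure_preimage hDm.nullMeasurableSet]
    refine measure_mono fun H hH => ?_
    have := hrot U hU2 _ hH
    rwa [mul_consCol, hUc] at this
  refine h1.trans ?_
  have hrow := measurePreserving_consRow v k n
  rw [← hrow.measure_preimage hDm.nullMeasurableSet]
  exact prod_apply_le_add _ _ (hrow.measurable hDm) (hdot _ hJ) _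
    fun g hg => hstep r (Real.sqrt_nonneg _) hrI g hg

theorem inv_sqrt_one_sub_le_exp {u : ℝ} (hu : |u| ≤ 1 / 4) :
    (Real.sqrt (1 - u))⁻¹ ≤ Real.exp ((u + u ^ 2) / 2) := by
  obtain ⟨h1, h2⟩ := abs_le.mp hu
  have hpos : 0 < 1 - u := by linarith
  have key : (1 - u)⁻¹ ≤ Real.exp (u + u ^ 2) := by
    rw [inv_le_iff_one_le_mul₀ hpos]
    rcases le_total 0 u with h0 | h0
    · have := Real.quadratic_le_exp_of_nonneg (x := u + u ^ 2) (by positivity)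
      nlinarith [mul_le_mul_of_nonneg_right this hpos.le, mul_nonneg h0 h0,
        mul_nonneg (mul_nonneg h0 h0) h0, mul_nonneg (mul_nonneg h0 h0) (sub_nonneg.2 h2),
        mul_nonneg (mul_nonneg (mul_nonneg h0 h0) h0) hpos.le,
        mul_nonneg (mul_nonneg (mul_nonneg (mul_nonneg h0 h0) h0) h0) hpos.le]
    · have := Real.add_one_le_exp (u + u ^ 2)
      nlinarith [mul_le_mul_of_nonneg_right this hpos.le, pow_nonneg (neg_nonneg.2 h0) 3]
  rw [← Real.sqrt_inv, show (u + u ^ 2) / 2 = (u + u ^ 2) * (1 / 2) by ring, Real.exp_mul,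
    ← Real.sqrt_eq_rpow]
  exact Real.sqrt_le_sqrt key

theorem integral_exp_mul_sq_gaussianReal {v : ℝ≥0} (hv : v ≠ 0) {t : ℝ} (ht : 2 * t * v < 1) :
    ∫ x, Real.exp (t * x ^ 2) ∂(gaussianReal 0 v) = (Real.sqrt (1 - 2 * t * v))⁻¹ := by
  have hv' : (0 : ℝ) < v := by positivity
  rw [integral_gaussianReal_eq_integral_smul hv]
  have h : ∀ x : ℝ, gaussianPDFReal 0 v x • Real.exp (t * x ^ 2) =
      (Real.sqrt (2 * Real.pi * v))⁻¹ * Real.exp (-(1 / (2 * v) - t) * x ^ 2) := by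
    intro x
    rw [gaussianPDFReal, smul_eq_mul, mul_assoc, ← Real.exp_add]
    congr 2
    field_simp
    ring
  simp_rw [h]
  rw [integral_const_mul, integral_gaussian, ← Real.sqrt_inv, ← Real.sqrt_inv,
    ← Real.sqrt_mul (by positivity)]
  congr 1
  have : 1 - 2 * t * v ≠ 0 := by linarith
  have : 1 / (2 * v) - t = (1 - 2 * t * v) / (2 * v) := by field_simp
  rw [this]
  field_simp

theorem integrable_and_mgf_gaussianVec_le {v : ℝ≥0} (hv : v ≠ 0) (n : ℕ) {t : ℝ}
    (ht : |2 * t * v| ≤ 1 / 4) :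
    Integrable (fun c : Fin n → ℝ => Real.exp (t * (c ⬝ᵥ c))) (gaussianVec v n) ∧
      mgf (fun c : Fin n → ℝ => c ⬝ᵥ c) (gaussianVec v n) t ≤
        Real.exp (n * (t * v + 2 * (t * v) ^ 2)) := by
  have hlt : 2 * t * v < 1 := by linarith [(abs_le.mp ht).2]
  have hprod : mgf (fun c : Fin n → ℝ => c ⬝ᵥ c) (gaussianVec v n) t =
      ((Real.sqrt (1 - 2 * t * v))⁻¹) ^ n := by
    have := integral_fintype_prod_eq_prod (𝕜 := ℝ) (μ := fun _ : Fin n => gaussianReal 0 v)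
      (fun _ : Fin n => fun x : ℝ => Real.exp (t * x ^ 2))
    simp only [integral_exp_mul_sq_gaussianReal hv hlt, Finset.prod_const, Finset.card_univ,
      Fintype.card_fin, ← Real.exp_sum, ← Finset.mul_sum] at this
    rw [← this, mgf]
    simp only [dotProduct, sq]
  constructor
  · refine not_imp_comm.1 integral_undef (ne_of_gt ?_)
    change 0 < mgf (fun c : Fin n → ℝ => c ⬝ᵥ c) (gaussianVec v n) t
    rw [hprod]
    have : 0 < 1 - 2 * t * v := by linarith
    positivity
  · rw [hprod, Real.exp_nat_mul]
    refine pow_le_pow_left₀ (by positivity) ?_ n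
    rw [show t * v + 2 * (t * v) ^ 2 = (2 * t * v + (2 * t * v) ^ 2) / 2 by ring]
    exact inv_sqrt_one_sub_le_exp ht

/-- Concentration of the squared norm of a Gaussian vector with entries of variance `1 / K`. -/
theorem gaussianVec_abs_dotProduct_sub_ge_le {K n : ℕ} (hK : 0 < K) (hn : n ≤ K) {ε : ℝ}
    (hε : 0 < ε) (hε' : ε ≤ 1 / 2) :
    gaussianVec (1 / K) n {c | ε ≤ |c ⬝ᵥ c - n / K|} ≤
      ENNReal.ofReal (2 * Real.exp (-(ε ^ 2 / 8 * K))) := by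
  have hK' : (0 : ℝ) < K := by exact_mod_cast hK
  have hnK : (n : ℝ) ≤ K := by exact_mod_cast hn
  have hv : (1 / K : ℝ≥0) ≠ 0 := by positivity
  have hvr : ((1 / K : ℝ≥0) : ℝ) = 1 / K := by simp
  set X : (Fin n → ℝ) → ℝ := fun c => c ⬝ᵥ c with hX
  have hsub : {c : Fin n → ℝ | ε ≤ |c ⬝ᵥ c - n / K|} ⊆
      {c | n / K + ε ≤ X c} ∪ {c | X c ≤ n / K - ε} := by
    intro c hc
    rcases le_abs.1 (show ε ≤ |c ⬝ᵥ c - n / K| from hc) with h | h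
    · left; change n / K + ε ≤ c ⬝ᵥ c; linarith
    · right; change c ⬝ᵥ c ≤ n / K - ε; linarith
  have habs : ∀ s : ℝ, |s| = 1 → |2 * (s * (ε / 4 * K)) * ((1 / K : ℝ≥0) : ℝ)| ≤ 1 / 4 := by
    intro s hs
    rw [hvr, show 2 * (s * (ε / 4 * K)) * (1 / K : ℝ) = s * (ε / 2) by field_simp; ring,
      abs_mul, hs, one_mul, abs_of_pos (by positivity)]
    linarith
  have hup := integrable_and_mgf_gaussianVec_le hv n (habs 1 (by simp))
  have hlo := integrable_and_mgf_gaussianVec_le hv n (habs (-1) (by simp))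
  have e1 := measure_ge_le_exp_mul_mgf (X := X) (n / K + ε) (by positivity) hup.1
  have e2 := measure_le_le_exp_mul_mgf (X := X) (n / K - ε)
    (by rw [neg_one_mul, neg_nonpos]; positivity) hlo.1
  have hbound : ∀ a b : ℝ, a + b ≤ -(ε ^ 2 / 8 * K) →
      Real.exp a * Real.exp b ≤ Real.exp (-(ε ^ 2 / 8 * K)) := fun a b h => by
    rw [← Real.exp_add]; exact Real.exp_le_exp.2 h
  have hn2 : ε ^ 2 * n ≤ ε ^ 2 * K := by gcongr
  have f1 : (gaussianVec (1 / K) n).real {c | n / K + ε ≤ X c} ≤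
      Real.exp (-(ε ^ 2 / 8 * K)) := by
    refine e1.trans ((mul_le_mul_of_nonneg_left hup.2 (Real.exp_nonneg _)).trans
      (hbound _ _ ?_))
    rw [hvr]
    field_simp
    nlinarith
  have f2 : (gaussianVec (1 / K) n).real {c | X c ≤ n / K - ε} ≤
      Real.exp (-(ε ^ 2 / 8 * K)) := by
    refine e2.trans ((mul_le_mul_of_nonneg_left hlo.2 (Real.exp_nonneg _)).trans
      (hbound _ _ ?_))
    rw [hvr]
    field_simp
    nlinarith
  rw [← ofReal_measureReal]
  refine ENNReal.ofReal_le_ofReal ?_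
  calc _ ≤ _ := measureReal_mono hsub
    _ ≤ _ := measureReal_union_le _ _
    _ ≤ _ := by linarith

theorem dotProduct_mulVec_self_of_orthogonal {n : ℕ} {U : Matrix (Fin n) (Fin n) ℝ}
    (hU : Uᵀ * U = 1) (x y : Fin n → ℝ) : (U *ᵥ x) ⬝ᵥ (U *ᵥ y) = x ⬝ᵥ y := by
  rw [Matrix.dotProduct_mulVec, ← Matrix.mulVec_transpose, Matrix.mulVec_mulVec, hU,
    Matrix.one_mulVec]

theorem dotProduct_self_eq_head_tail {n : ℕ} (x : Fin (n + 1) → ℝ) :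
    x ⬝ᵥ x = x 0 ^ 2 + Fin.tail x ⬝ᵥ Fin.tail x := by
  simp [dotProduct, Fin.sum_univ_succ, Fin.tail, sq]

theorem dotProduct_mulVec_peeled {k n : ℕ} (r : ℝ) (g : Fin n → ℝ)
    (H : Matrix (Fin k) (Fin n) ℝ) (x : Fin (n + 1) → ℝ) :
    (consCol (Pi.single 0 r) (consRow g H) *ᵥ x) ⬝ᵥ (consCol (Pi.single 0 r) (consRow g H) *ᵥ x) =
      (r * x 0 + g ⬝ᵥ Fin.tail x) ^ 2 + (H *ᵥ Fin.tail x) ⬝ᵥ (H *ᵥ Fin.tail x) := by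
  have h0 : consRow g H 0 = g := rfl
  have hs : ∀ i : Fin k, consRow g H i.succ = H i := fun _ => rfl
  rw [dotProduct_self_eq_head_tail]
  congr 2
  · simp [consCol, h0, Matrix.mulVec, dotProduct, Fin.sum_univ_succ, Fin.tail]
  all_goals
    ext i
    simp [consCol, hs, Matrix.mulVec, dotProduct, Fin.sum_univ_succ, Fin.tail]

theorem measurableSet_matrix_of_isOpen {k n : ℕ} {B : Set (Matrix (Fin k) (Fin n) ℝ)}
    (hB : IsOpen B) : MeasurableSet B := by
  have : BorelSpace (Matrix (Fin k) (Fin n) ℝ) := inferInstanceAs (BorelSpace (Fin k → Fin n → ℝ))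
  exact hB.measurableSet

/-- Matrices for which `σ |G x|² ≤ b |x|² - θ x₀²` fails for some `x`. -/
def quadBad (σ b θ : ℝ) (k n : ℕ) : Set (Matrix (Fin k) (Fin (n + 1)) ℝ) :=
  {G | ∃ x, b * (x ⬝ᵥ x) - θ * x 0 ^ 2 < σ * ((G *ᵥ x) ⬝ᵥ (G *ᵥ x))}

theorem measurableSet_quadBad (σ b θ : ℝ) (k n : ℕ) : MeasurableSet (quadBad σ b θ k n) := by
  apply measurableSet_matrix_of_isOpen
  have : quadBad σ b θ k n =
      ⋃ x, {G | b * (x ⬝ᵥ x) - θ * x 0 ^ 2 < σ * ((G *ᵥ x) ⬝ᵥ (G *ᵥ x))} := by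
    ext G; simp [quadBad]
  rw [this]
  exact isOpen_iUnion fun x => isOpen_lt continuous_const (by fun_prop)

theorem gaussianMat_quadBad_le (v : ℝ≥0) {K k₀ d : ℕ} (hk₀ : 1 ≤ k₀) {σ b θ lo hi w : ℝ}
    {δ : ℝ≥0∞}
    (hC : ∀ r s : ℝ, 0 ≤ r → 0 ≤ s → lo ≤ r * r → r * r ≤ hi → s * s ≤ w →
      ∀ x y : ℝ, σ * (r * x + s * y) ^ 2 ≤ (b - θ) * x ^ 2 + θ * y ^ 2)
    (hI : ∀ k, k₀ ≤ k → k ≤ K → gaussianVec v k {c | c ⬝ᵥ c ∉ Set.Icc lo hi} ≤ δ)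
    (hJ : ∀ n ≤ d, gaussianVec v n {g | g ⬝ᵥ g ∉ Set.Iic w} ≤ δ)
    (n k : ℕ) (hn : n ≤ d) (hk : k ≤ K) (hkn : k₀ + n ≤ k) :
    gaussianMat v k (n + 1) (quadBad σ b θ k n) ≤ (n + 1 : ℕ) * (δ + δ) := by
  induction n generalizing k with
  | zero =>
    obtain ⟨k, rfl⟩ : ∃ k', k = k' + 1 := ⟨k - 1, by omega⟩
    refine (gaussianMat_le_of_peel v (measurableSet_quadBad _ _ _ _ _) (I := Set.Icc lo hi)
      (J := Set.Iic w) measurableSet_Icc measurableSet_Iic ?_ 0 ?_).trans ?_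
    · rintro U hU G ⟨x, hx⟩
      exact ⟨x, by rwa [← Matrix.mulVec_mulVec, dotProduct_mulVec_self_of_orthogonal hU]⟩
    · rintro r hr ⟨hlo, hhi⟩ g hg
      have hw : (0 : ℝ) * 0 ≤ w := by simpa [dotProduct] using hg
      refine le_of_eq (measure_mono_null (t := ∅) ?_ measure_empty)
      rintro H ⟨x, hx⟩
      rw [dotProduct_mulVec_peeled, dotProduct_self_eq_head_tail] at hx
      have := hC r 0 hr le_rfl hlo hhi hw (x 0) 0
      simp [dotProduct] at hx this
      linarith
    · simpa using add_le_add (hI (k + 1) (by omega) hk) (hJ 0 (by omega))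
  | succ n ih =>
    obtain ⟨k, rfl⟩ : ∃ k', k = k' + 1 := ⟨k - 1, by omega⟩
    have ih' := ih k (by omega) (by omega) (by omega)
    refine (gaussianMat_le_of_peel v (measurableSet_quadBad _ _ _ _ _) (I := Set.Icc lo hi)
      (J := Set.Iic w) measurableSet_Icc measurableSet_Iic ?_ _
      (fun r hr hrI g hg => le_trans ?_ ih')).trans ?_
    · rintro U hU G ⟨x, hx⟩
      exact ⟨x, by rwa [← Matrix.mulVec_mulVec, dotProduct_mulVec_self_of_orthogonal hU]⟩
    · obtain ⟨V, hV1, hV2, hVg⟩ := exists_orthogonal_mulVec_eq_single g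
      have hgg : 0 ≤ g ⬝ᵥ g := Finset.sum_nonneg fun i _ => mul_self_nonneg _
      set s := Real.sqrt (g ⬝ᵥ g) with hs
      have hsw : s * s ≤ w := by rw [Real.mul_self_sqrt hgg]; exact hg
      rw [← (measurePreserving_mul_right_gaussianMat v k (V := Vᵀ)
        (by simpa using hV1)).measure_preimage (measurableSet_quadBad _ _ _ _ _).nullMeasurableSet]
      refine measure_mono ?_
      rintro H ⟨x, hx⟩
      refine ⟨V *ᵥ Fin.tail x, ?_⟩
      have hgx : g ⬝ᵥ Fin.tail x = s * (V *ᵥ Fin.tail x) 0 := by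
        rw [← dotProduct_mulVec_self_of_orthogonal hV2, hVg, single_dotProduct]
      rw [dotProduct_mulVec_peeled, dotProduct_self_eq_head_tail, hgx] at hx
      rw [Matrix.mulVec_mulVec, Matrix.mul_assoc, hV2, Matrix.mul_one,
        dotProduct_mulVec_self_of_orthogonal hV2]
      have := hC r s hr (Real.sqrt_nonneg _) hrI.1 hrI.2 hsw (x 0) ((V *ᵥ Fin.tail x) 0)
      linarith
    · calc _ ≤ δ + (δ + ((n + 1 : ℕ) : ℝ≥0∞) * (δ + δ)) := by
            gcongr
            · exact hI (k + 1) (by omega) hk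
            · exact hJ (n + 1) hn
        _ = _ := by push_cast; ring

/-- Matrices with no vector `x` such that `x₀ = 1`, `|x|² ≤ L + 1` and `|G x|² > L c - 1`. -/
def testBad (c : ℝ) (L k n : ℕ) : Set (Matrix (Fin k) (Fin (n + 1)) ℝ) :=
  {G | ∀ x : Fin (n + 1) → ℝ, x 0 = 1 → x ⬝ᵥ x ≤ L + 1 →
    (G *ᵥ x) ⬝ᵥ (G *ᵥ x) ≤ L * c - 1}

theorem mem_testBad {c : ℝ} {L k n : ℕ} {G : Matrix (Fin k) (Fin (n + 1)) ℝ} :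
    G ∈ testBad c L k n ↔ ∀ x : Fin (n + 1) → ℝ, x 0 = 1 → x ⬝ᵥ x ≤ L + 1 →
      (G *ᵥ x) ⬝ᵥ (G *ᵥ x) ≤ L * c - 1 := Iff.rfl

theorem measurableSet_testBad (c : ℝ) (L k n : ℕ) : MeasurableSet (testBad c L k n) := by
  rw [← MeasurableSet.compl_iff]
  apply measurableSet_matrix_of_isOpen
  rw [isOpen_compl_iff]
  have : testBad c L k n = ⋂ (x : Fin (n + 1) → ℝ) (_ : x 0 = 1) (_ : x ⬝ᵥ x ≤ L + 1),
      {G | (G *ᵥ x) ⬝ᵥ (G *ᵥ x) ≤ L * c - 1} := by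
    ext G; simp [testBad]
  rw [this]
  exact isClosed_iInter fun x => isClosed_iInter fun _ => isClosed_iInter fun _ =>
    isClosed_le (by fun_prop) continuous_const

theorem gaussianMat_testBad_le (v : ℝ≥0) {K k₀ d n₀ : ℕ} (hn₀ : 1 ≤ n₀) {c lo w : ℝ} {δ : ℝ≥0∞}
    (hC : ∀ r s : ℝ, 0 ≤ r → 0 ≤ s → lo ≤ r * r → w ≤ s * s → c ≤ (r + s) ^ 2)
    (hI : ∀ k, k₀ ≤ k → k ≤ K → gaussianVec v k {c | c ⬝ᵥ c ∉ Set.Ici lo} ≤ δ)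
    (hJ : ∀ n, n₀ ≤ n → n ≤ d → gaussianVec v n {g | g ⬝ᵥ g ∉ Set.Ici w} ≤ δ)
    (L n k : ℕ) (hn : n ≤ d) (hk : k ≤ K) (hkL : k₀ + L ≤ k) (hnL : n₀ + L ≤ n + 1) :
    gaussianMat v k (n + 1) (testBad c L k n) ≤ L * (δ + δ) := by
  induction L generalizing k n with
  | zero =>
    refine le_of_eq_of_le (measure_mono_null (t := ∅) ?_ measure_empty) zero_le
    intro G hG
    have h1 := mem_testBad.1 hG (Pi.single 0 1) (by simp) (by simp)
    have h2 : 0 ≤ (G *ᵥ Pi.single 0 1) ⬝ᵥ (G *ᵥ Pi.single 0 1) :=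
      Finset.sum_nonneg fun i _ => mul_self_nonneg _
    rw [Nat.cast_zero, zero_mul, zero_sub] at h1
    linarith
  | succ L ih =>
    obtain ⟨k, rfl⟩ : ∃ k', k = k' + 1 := ⟨k - 1, by omega⟩
    obtain ⟨n, rfl⟩ : ∃ n', n = n' + 1 := ⟨n - 1, by omega⟩
    have ih' := ih n k (by omega) (by omega) (by omega) (by omega)
    refine (gaussianMat_le_of_peel v (measurableSet_testBad _ _ _ _) (I := Set.Ici lo)
      (J := Set.Ici w) measurableSet_Ici measurableSet_Ici ?_ _
      (fun r hr hrI g hg => le_trans ?_ ih')).trans ?_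
    · refine fun U hU G hG => mem_testBad.2 fun x hx1 hx2 => ?_
      rw [← Matrix.mulVec_mulVec, dotProduct_mulVec_self_of_orthogonal hU]
      exact mem_testBad.1 hG x hx1 hx2
    · obtain ⟨V, hV1, hV2, hVg⟩ := exists_orthogonal_mulVec_eq_single g
      have hgg : 0 ≤ g ⬝ᵥ g := Finset.sum_nonneg fun i _ => mul_self_nonneg _
      set s := Real.sqrt (g ⬝ᵥ g) with hs
      have hsw : w ≤ s * s := by rw [Real.mul_self_sqrt hgg]; exact hg
      rw [← (measurePreserving_mul_right_gaussianMat v k (V := Vᵀ)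
        (by simpa using hV1)).measure_preimage (measurableSet_testBad _ _ _ _).nullMeasurableSet]
      refine measure_mono ?_
      refine fun H hH => mem_testBad.2 fun y hy1 hy2 => ?_
      have hVT : Vᵀᵀ * Vᵀ = 1 := by simpa using hV1
      have h := mem_testBad.1 hH (Fin.cons 1 (Vᵀ *ᵥ y)) (by simp) (by
        rw [dotProduct_self_eq_head_tail]
        simp only [Fin.cons_zero, Fin.tail_cons, dotProduct_mulVec_self_of_orthogonal hVT]
        push_cast
        linarith)
      have hgy : g ⬝ᵥ (Vᵀ *ᵥ y) = s := by
        rw [← dotProduct_mulVec_self_of_orthogonal hV2, hVg, Matrix.mulVec_mulVec, hV1,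
          Matrix.one_mulVec, single_dotProduct, hy1, mul_one]
      rw [dotProduct_mulVec_peeled] at h
      simp only [Fin.cons_zero, Fin.tail_cons, hgy, mul_one, Matrix.mulVec_mulVec] at h
      have := hC r s hr (Real.sqrt_nonneg _) hrI hsw
      push_cast at h
      linarith
    · calc _ ≤ δ + (δ + (L : ℝ≥0∞) * (δ + δ)) := by
            gcongr
            · exact hI (k + 1) (by omega) hk
            · exact hJ (n + 1) (by omega) hn
        _ = _ := by push_cast; ring

theorem sigmaMax_le_of_abs_quadratic_le {d : ℕ} {N : Matrix (Fin d) (Fin d) ℝ} (hN : Nᵀ = N)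
    {C : ℝ} (hC : 0 ≤ C) (h : ∀ x : Fin d → ℝ, |x ⬝ᵥ (N *ᵥ x)| ≤ C * (x ⬝ᵥ x)) :
    sigmaMax N ≤ C := by
  have heig : ∀ (x : Fin d → ℝ) (s : ℝ), x ≠ 0 → N *ᵥ x = s • x → |s| ≤ C := by
    intro x s hx hs
    have hxx : 0 < x ⬝ᵥ x :=
      lt_of_le_of_ne (Finset.sum_nonneg fun i _ => mul_self_nonneg _)
        (Ne.symm (by simpa [dotProduct_self_eq_zero] using hx))
    have := h x
    rw [hs, dotProduct_smul, smul_eq_mul, abs_mul, abs_of_pos hxx] at this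
    exact le_of_mul_le_mul_right this hxx
  unfold sigmaMax lambdaMax
  rw [Real.sqrt_le_left hC, hN]
  refine Real.sSup_le (fun μ hμ => ?_) (by positivity)
  rcases lt_or_ge μ 0 with h0 | h0
  · exact h0.le.trans (by positivity)
  set s := Real.sqrt μ with hs
  have hss : s * s = μ := Real.mul_self_sqrt h0
  have hfac : algebraMap ℝ (Matrix (Fin d) (Fin d) ℝ) μ - N * N =
      (s • 1 - N) * (s • 1 + N) := by
    rw [Algebra.algebraMap_eq_smul_one, ← hss]
    simp only [sub_mul, mul_add, smul_mul_assoc, mul_smul_comm, one_mul, mul_one]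
    module
  rw [spectrum.mem_iff, hfac, Matrix.isUnit_iff_isUnit_det, isUnit_iff_ne_zero, not_not,
    Matrix.det_mul, mul_eq_zero, ← Matrix.exists_mulVec_eq_zero_iff,
    ← Matrix.exists_mulVec_eq_zero_iff] at hμ
  have hsC : |s| ≤ C := by
    rcases hμ with ⟨x, hx, h1⟩ | ⟨x, hx, h1⟩
    · refine heig x s hx ?_
      rw [Matrix.sub_mulVec, Matrix.smul_mulVec, Matrix.one_mulVec, sub_eq_zero] at h1
      exact h1.symm
    · rw [← abs_neg]
      refine heig x (-s) hx ?_
      rw [Matrix.add_mulVec, Matrix.smul_mulVec, Matrix.one_mulVec] at h1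
      rw [neg_smul]
      exact eq_neg_of_add_eq_zero_right h1
  rw [← hss, ← sq, ← sq_abs]
  exact pow_le_pow_left₀ (abs_nonneg _) hsC 2

theorem dotProduct_mulVec_self_le_lambdaMax {a b : ℕ} (N : Matrix (Fin a) (Fin b) ℝ)
    (x : Fin b → ℝ) : (N *ᵥ x) ⬝ᵥ (N *ᵥ x) ≤ lambdaMax (Nᵀ * N) * (x ⬝ᵥ x) := by
  set A := Nᵀ * N with hA
  have hAT : Aᵀ = A := by simp [hA]
  have hbdd : BddAbove (spectrum ℝ A) := (Matrix.finite_real_spectrum (A := A)).bddAbove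
  have hpsd : (lambdaMax A • (1 : Matrix (Fin b) (Fin b) ℝ) - A).PosSemidef := by
    rw [Matrix.posSemidef_iff_isHermitian_and_spectrum_nonneg]
    refine ⟨by simp [Matrix.IsHermitian, Matrix.conjTranspose_eq_transpose_of_trivial, hAT],
      fun μ hμ => ?_⟩
    rw [← Algebra.algebraMap_eq_smul_one, ← spectrum.singleton_sub_eq] at hμ
    obtain ⟨_, rfl, μ', hμ', rfl⟩ := hμ
    exact sub_nonneg.2 (le_csSup hbdd hμ')
  have := hpsd.dotProduct_mulVec_nonneg x
  rw [star_trivial, Matrix.sub_mulVec, dotProduct_sub, Matrix.smul_mulVec, Matrix.one_mulVec,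
    dotProduct_smul, smul_eq_mul, hA, ← Matrix.mulVec_mulVec, Matrix.dotProduct_mulVec x Nᵀ,
    Matrix.vecMul_transpose] at this
  linarith

theorem le_sigmaMax_of_le_quadratic {d : ℕ} {N : Matrix (Fin d) (Fin d) ℝ} {β : ℝ} (hβ : 0 ≤ β)
    {x : Fin d → ℝ} (hx : 0 < x ⬝ᵥ x) (h : β * (x ⬝ᵥ x) ≤ x ⬝ᵥ (N *ᵥ x)) :
    β ≤ sigmaMax N := by
  apply Real.le_sqrt_of_sq_le
  have h1 := dotProduct_mulVec_self_le_lambdaMax N x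
  have h2 : (x ⬝ᵥ (N *ᵥ x)) ^ 2 ≤ (x ⬝ᵥ x) * ((N *ᵥ x) ⬝ᵥ (N *ᵥ x)) := by
    simpa [dotProduct, sq] using Finset.sum_mul_sq_le_sq_mul_sq Finset.univ x (N *ᵥ x)
  have h3 : (β * (x ⬝ᵥ x)) ^ 2 ≤ (x ⬝ᵥ (N *ᵥ x)) ^ 2 := pow_le_pow_left₀ (by positivity) h 2
  have h4 := mul_le_mul_of_nonneg_left h1 hx.le
  have h5 : β ^ 2 * (x ⬝ᵥ x) ^ 2 ≤ lambdaMax (Nᵀ * N) * (x ⬝ᵥ x) ^ 2 := by linarith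
  exact le_of_mul_le_mul_right h5 (by positivity)

theorem dotProduct_one_sub_gram_mulVec {k d : ℕ} (G : Matrix (Fin k) (Fin d) ℝ) (x : Fin d → ℝ) :
    x ⬝ᵥ ((Gᵀ * G - 1) *ᵥ x) = (G *ᵥ x) ⬝ᵥ (G *ᵥ x) - x ⬝ᵥ x := by
  rw [Matrix.sub_mulVec, dotProduct_sub, Matrix.one_mulVec, ← Matrix.mulVec_mulVec,
    Matrix.dotProduct_mulVec x Gᵀ, Matrix.vecMul_transpose]

theorem sigmaMax_neg {a b : ℕ} (N : Matrix (Fin a) (Fin b) ℝ) : sigmaMax (-N) = sigmaMax N := by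
  simp [sigmaMax]

/-- The tail bound for squared norms of Gaussian vectors in dimension at most `K`. -/
noncomputable def normTail (ε : ℝ) (K : ℕ) : ℝ≥0∞ :=
  ENNReal.ofReal (2 * Real.exp (-(ε ^ 2 / 8 * K)))

theorem gaussianVec_le_normTail {K n : ℕ} (hK : 0 < K) (hn : n ≤ K) {ε : ℝ} (hε : 0 < ε)
    (hε' : ε ≤ 1 / 2) {S : Set ℝ} (hS : ∀ y : ℝ, |y - n / K| < ε → y ∈ S) :
    gaussianVec (1 / K) n {c | c ⬝ᵥ c ∉ S} ≤ normTail ε K := by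
  refine (measure_mono fun c hc => ?_).trans (gaussianVec_abs_dotProduct_sub_ge_le hK hn hε hε')
  by_contra h
  exact hc (hS _ (not_le.1 h))

theorem tendsto_mul_normTail {ε : ℝ} (hε : 0 < ε) {k : ℕ → ℕ} (hk : Tendsto k atTop atTop)
    (A : ℝ≥0∞) (hA : A ≠ ∞) :
    Tendsto (fun m => A * ((k m : ℝ≥0∞) * normTail ε (k m))) atTop (nhds 0) := by
  have hc : 0 < ε ^ 2 / 8 := by positivity
  have h1 := tendsto_rpow_mul_exp_neg_mul_atTop_nhds_zero 1 _ hc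
  have h2 : Tendsto (fun m => 2 * ((k m : ℝ) ^ (1 : ℝ) * Real.exp (-(ε ^ 2 / 8) * (k m : ℝ)))) atTop
      (nhds 0) := by
    simpa using (h1.comp (tendsto_natCast_atTop_atTop.comp hk)).const_mul 2
  have h3 := (ENNReal.tendsto_ofReal h2)
  rw [ENNReal.ofReal_zero] at h3
  have h4 := ENNReal.Tendsto.const_mul (a := A) h3 (Or.inr hA)
  rw [mul_zero] at h4
  refine h4.congr fun m => ?_
  rw [normTail, ← ENNReal.ofReal_natCast, ← ENNReal.ofReal_mul (by positivity)]
  rw [Real.rpow_one]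
  congr 2
  ring_nf

theorem gaussianMatrix_sigmaMax_gt_le {a ε : ℝ} (ha0 : 0 < a) (ha1 : a ≤ 1) (hε : 0 < ε) :
    ∃ η > 0, ∀ K n : ℕ, n + 1 ≤ K → |((n + 1 : ℕ) : ℝ) / K - a ^ 2| ≤ η →
      gaussianMatrix K (n + 1) {G | (1 + a) ^ 2 - 1 + ε < sigmaMax (1 - Gᵀ * G)} ≤
        4 * (K * normTail η K) := by
  obtain ⟨η, hη, hη1, hη2, hη3⟩ :
      ∃ η > 0, η ≤ 1 / 2 ∧ 2 * η ≤ ε * a / 4 ∧ 2 * η ≤ a ^ 3 := by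
    refine ⟨min (1 / 2) (min (ε * a / 8) (a ^ 3 / 2)), by positivity, min_le_left _ _, ?_, ?_⟩
    · have := (min_le_right (1 / 2) (min (ε * a / 8) (a ^ 3 / 2))).trans (min_le_left _ _)
      linarith
    · have := (min_le_right (1 / 2) (min (ε * a / 8) (a ^ 3 / 2))).trans (min_le_right _ _)
      linarith
  refine ⟨η, hη, fun K n hnK hα => ?_⟩
  have hK : 0 < K := by omega
  have hK' : (0 : ℝ) < K := by exact_mod_cast hK
  obtain ⟨hα1, hα2⟩ := abs_le.1 hα
  have hnα : (n : ℝ) / K ≤ a ^ 2 + η := by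
    have : (n : ℝ) / K ≤ ((n + 1 : ℕ) : ℝ) / K := by gcongr; omega
    linarith
  set C := (1 + a) ^ 2 - 1 + ε with hC
  have hεa : ε * a ≤ ε := by nlinarith
  have hI : ∀ k, K - n ≤ k → k ≤ K → gaussianVec (1 / K) k
      {c | c ⬝ᵥ c ∉ Set.Icc (1 - a ^ 2 - 2 * η) (1 + 2 * η)} ≤ normTail η K := by
    intro k hk1 hk2
    refine gaussianVec_le_normTail hK hk2 hη hη1 fun y hy => ?_
    obtain ⟨hy1, hy2⟩ := abs_lt.1 hy
    have h1 : (k : ℝ) / K ≤ 1 := (div_le_one hK').2 (by exact_mod_cast hk2)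
    have h2 : 1 - (n : ℝ) / K ≤ k / K := by
      rw [one_sub_div hK'.ne']
      gcongr
      have : (K : ℝ) ≤ k + n := by exact_mod_cast (by omega : K ≤ k + n)
      linarith
    constructor <;> linarith
  have hJ : ∀ n' ≤ n, gaussianVec (1 / K) n' {g | g ⬝ᵥ g ∉ Set.Iic (a ^ 2 + 2 * η)} ≤
      normTail η K := by
    intro n' hn'
    refine gaussianVec_le_normTail hK (by omega) hη hη1 fun y hy => ?_
    obtain ⟨hy1, hy2⟩ := abs_lt.1 hy
    have : (n' : ℝ) / K ≤ (n : ℝ) / K := by gcongr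
    change y ≤ _
    linarith
  have hup : gaussianMat (1 / K) K (n + 1) (quadBad 1 (C + 1) (a ^ 2 + a + ε / 2) K n) ≤
      (n + 1 : ℕ) * (normTail η K + normTail η K) := by
    refine gaussianMat_quadBad_le _ (by omega) ?_ hI hJ n K le_rfl le_rfl (by omega)
    intro r s _ _ _ hr hs x y
    have h1 : 1 * (r * x + s * y) ^ 2 ≤
        ((1 + a) * (r * r)) * x ^ 2 + ((1 + 1 / a) * (s * s)) * y ^ 2 := by
      have : ((1 + a) * (r * r)) * x ^ 2 + ((1 + 1 / a) * (s * s)) * y ^ 2 -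
          1 * (r * x + s * y) ^ 2 = (a * r * x - s * y) ^ 2 / a := by
        field_simp; ring
      have : 0 ≤ (a * r * x - s * y) ^ 2 / a := by positivity
      linarith
    have h2 : (1 + a) * (r * r) ≤ C + 1 - (a ^ 2 + a + ε / 2) := by nlinarith
    have h3 : (1 + 1 / a) * (s * s) ≤ a ^ 2 + a + ε / 2 := by
      have : 1 + 1 / a = (a + 1) / a := by field_simp
      rw [this, div_mul_eq_mul_div, div_le_iff₀ ha0]
      nlinarith
    have := mul_le_mul_of_nonneg_right h2 (sq_nonneg x)
    have := mul_le_mul_of_nonneg_right h3 (sq_nonneg y)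
    linarith
  have hlo : gaussianMat (1 / K) K (n + 1) (quadBad (-1) (C - 1) a K n) ≤
      (n + 1 : ℕ) * (normTail η K + normTail η K) := by
    refine gaussianMat_quadBad_le _ (by omega) ?_ hI hJ n K le_rfl le_rfl (by omega)
    intro r s _ _ hr _ hs x y
    have h1 : -1 * (r * x + s * y) ^ 2 ≤
        (-(1 - a) * (r * r)) * x ^ 2 + ((1 / a - 1) * (s * s)) * y ^ 2 := by
      have : (-(1 - a) * (r * r)) * x ^ 2 + ((1 / a - 1) * (s * s)) * y ^ 2 -
          -1 * (r * x + s * y) ^ 2 = (a * r * x + s * y) ^ 2 / a := by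
        field_simp; ring
      have : 0 ≤ (a * r * x + s * y) ^ 2 / a := by positivity
      linarith
    have h2 : -(1 - a) * (r * r) ≤ C - 1 - a := by
      have := mul_le_mul_of_nonneg_left hr (sub_nonneg.2 ha1)
      nlinarith [pow_pos ha0 3, mul_nonneg hη.le ha0.le]
    have h3 : (1 / a - 1) * (s * s) ≤ a := by
      have : 1 / a - 1 = (1 - a) / a := by field_simp
      rw [this, div_mul_eq_mul_div, div_le_iff₀ ha0]
      have := mul_le_mul_of_nonneg_left hs (sub_nonneg.2 ha1)
      nlinarith [mul_nonneg hη.le ha0.le]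
    have := mul_le_mul_of_nonneg_right h2 (sq_nonneg x)
    have := mul_le_mul_of_nonneg_right h3 (sq_nonneg y)
    linarith
  have hsub : {G : Matrix (Fin K) (Fin (n + 1)) ℝ | C < sigmaMax (1 - Gᵀ * G)} ⊆
      quadBad 1 (C + 1) (a ^ 2 + a + ε / 2) K n ∪ quadBad (-1) (C - 1) a K n := by
    intro G hG
    by_contra hbad
    rw [Set.mem_union, not_or] at hbad
    refine absurd (show C < sigmaMax (1 - Gᵀ * G) from hG) (not_lt.2 ?_)
    rw [← neg_sub (Gᵀ * G), sigmaMax_neg]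
    refine sigmaMax_le_of_abs_quadratic_le (by simp) (by rw [hC]; nlinarith) fun x => ?_
    rw [dotProduct_one_sub_gram_mulVec, abs_le]
    have h1 := not_lt.1 fun h => hbad.1 ⟨x, h⟩
    have h2 := not_lt.1 fun h => hbad.2 ⟨x, h⟩
    have h3 : 0 ≤ (a ^ 2 + a + ε / 2) * x 0 ^ 2 := by positivity
    have h4 : 0 ≤ a * x 0 ^ 2 := by positivity
    constructor <;> linarith
  calc gaussianMatrix K (n + 1) {G | C < sigmaMax (1 - Gᵀ * G)}
      ≤ _ := measure_mono hsub
    _ ≤ _ := measure_union_le _ _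
    _ ≤ _ := add_le_add hup hlo
    _ ≤ K * (normTail η K + normTail η K) + K * (normTail η K + normTail η K) := by gcongr
    _ = 4 * (K * normTail η K) := by ring

theorem gaussianMatrix_sigmaMax_lt_le {a ε : ℝ} (ha0 : 0 < a) (ha1 : a ≤ 1) (hε : 0 < ε) :
    ∃ η > 0, ∃ L : ℕ, ∀ K n : ℕ, n + 1 ≤ K → L ≤ n → (L : ℝ) / K ≤ η →
      |((n + 1 : ℕ) : ℝ) / K - a ^ 2| ≤ η →
      gaussianMatrix K (n + 1) {G | sigmaMax (1 - Gᵀ * G) < (1 + a) ^ 2 - 1 - ε} ≤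
        2 * (K * normTail η K) := by
  set τ := min (ε / 8) a with hτ
  have hτ0 : 0 < τ := by positivity
  have hτ1 : τ ≤ ε / 8 := min_le_left _ _
  have hτ2 : τ ≤ a := min_le_right _ _
  obtain ⟨η, hη, hη1, hη2⟩ : ∃ η > 0, η ≤ 1 / 6 ∧ 3 * η ≤ a * τ / 2 := by
    refine ⟨min (1 / 6) (a * τ / 6), by positivity, min_le_left _ _, ?_⟩
    have := min_le_right (1 / 6) (a * τ / 6)
    linarith
  obtain ⟨L, hL⟩ := exists_nat_ge (10 / ε)
  refine ⟨η, hη, L, fun K n hnK hLn hLK hα => ?_⟩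
  have hK : 0 < K := by omega
  have hK' : (0 : ℝ) < K := by exact_mod_cast hK
  obtain ⟨hα1, hα2⟩ := abs_le.1 hα
  set c := (1 + a) ^ 2 - ε / 2 with hc
  have hI : ∀ k, K - L ≤ k → k ≤ K → gaussianVec (1 / K) k
      {c | c ⬝ᵥ c ∉ Set.Ici (1 - 3 * η)} ≤ normTail η K := by
    intro k hk1 hk2
    refine gaussianVec_le_normTail hK hk2 hη (by linarith) fun y hy => ?_
    obtain ⟨hy1, hy2⟩ := abs_lt.1 hy
    have h2 : 1 - (L : ℝ) / K ≤ k / K := by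
      rw [one_sub_div hK'.ne']
      gcongr
      have : (K : ℝ) ≤ k + L := by exact_mod_cast (by omega : K ≤ k + L)
      linarith
    change _ ≤ y
    linarith
  have hJ : ∀ n', n + 1 - L ≤ n' → n' ≤ n → gaussianVec (1 / K) n'
      {g | g ⬝ᵥ g ∉ Set.Ici (a ^ 2 - 3 * η)} ≤ normTail η K := by
    intro n' hn1 hn2
    refine gaussianVec_le_normTail hK (by omega) hη (by linarith) fun y hy => ?_
    obtain ⟨hy1, hy2⟩ := abs_lt.1 hy
    have h2 : ((n + 1 : ℕ) : ℝ) / K - (L : ℝ) / K ≤ n' / K := by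
      rw [← sub_div]
      gcongr
      have : ((n + 1 : ℕ) : ℝ) ≤ n' + L := by exact_mod_cast (by omega : n + 1 ≤ n' + L)
      linarith
    change _ ≤ y
    linarith
  have hbad : gaussianMat (1 / K) K (n + 1) (testBad c L K n) ≤
      L * (normTail η K + normTail η K) := by
    refine gaussianMat_testBad_le _ (by omega : 1 ≤ n + 1 - L) ?_ hI hJ L n K le_rfl le_rfl
      (by omega) (by omega)
    intro r s hr hs hr2 hs2
    have haτ : 3 * η ≤ τ / 2 := by nlinarith
    have h1 : (a - τ) ^ 2 ≤ (r * s) ^ 2 := by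
      have h2 : (1 - 3 * η) * (a ^ 2 - 3 * η) ≤ (r * r) * (s * s) := by
        calc (1 - 3 * η) * (a ^ 2 - 3 * η) ≤ (1 - 3 * η) * (s * s) := by
              apply mul_le_mul_of_nonneg_left hs2; linarith
          _ ≤ _ := mul_le_mul_of_nonneg_right hr2 (mul_self_nonneg s)
      nlinarith [sq_nonneg η, mul_nonneg hτ0.le (sub_nonneg.2 hτ2),
        mul_le_mul ha1 ha1 ha0.le one_pos.le]
    have h3 : a - τ ≤ r * s := abs_le_of_sq_le_sq' h1 (by positivity) |>.2
    nlinarith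
  have hsub : {G : Matrix (Fin K) (Fin (n + 1)) ℝ |
      sigmaMax (1 - Gᵀ * G) < (1 + a) ^ 2 - 1 - ε} ⊆ testBad c L K n := by
    intro G hG
    have hlt : sigmaMax (1 - Gᵀ * G) < (1 + a) ^ 2 - 1 - ε := hG
    have hβ : 0 ≤ (1 + a) ^ 2 - 1 - ε := (Real.sqrt_nonneg _).trans hlt.le
    refine mem_testBad.2 fun x hx0 hxL => ?_
    by_contra hGx
    rw [not_le] at hGx
    refine absurd hlt (not_lt.2 ?_)
    rw [← neg_sub (Gᵀ * G), sigmaMax_neg]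
    have hxx : 0 < x ⬝ᵥ x := by
      rw [dotProduct_self_eq_head_tail, hx0]
      have : 0 ≤ Fin.tail x ⬝ᵥ Fin.tail x := Finset.sum_nonneg fun i _ => mul_self_nonneg _
      linarith
    refine le_sigmaMax_of_le_quadratic hβ hxx ?_
    rw [dotProduct_one_sub_gram_mulVec]
    have h1 := mul_le_mul_of_nonneg_left hxL
      (show 0 ≤ (1 + a) ^ 2 - ε by linarith)
    have h2 : 10 ≤ L * ε := (div_le_iff₀ hε).1 hL
    have h3 : (1 + a) ^ 2 ≤ 4 := by nlinarith
    have h4 : L * c - 1 - ((1 + a) ^ 2 - ε) * (L + 1) = L * ε / 2 - 1 - (1 + a) ^ 2 + ε := by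
      rw [hc]; ring
    linarith
  calc gaussianMatrix K (n + 1) {G | sigmaMax (1 - Gᵀ * G) < (1 + a) ^ 2 - 1 - ε}
      ≤ _ := measure_mono hsub
    _ ≤ _ := hbad
    _ ≤ K * (normTail η K + normTail η K) := by gcongr; omega
    _ = 2 * (K * normTail η K) := by ring

/-- For `G` a `k_m × d_m` matrix of independent `N(0, 1/k_m)` entries, `d_m ≤ k_m`,
`d_m, k_m → ∞` and `d_m / k_m → α ∈ (0, 1]`, the largest singular value
`σ_max(I_{d_m} − Gᵀ G)` converges in probability to `(1 + √α)² − 1`. -/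
theorem sigmaMax_one_sub_wishart_tendsto
    (k d : ℕ → ℕ) (α : ℝ) (hα0 : 0 < α) (hα1 : α ≤ 1)
    (hdk : ∀ m, d m ≤ k m)
    (htd : Tendsto (fun m => d m) atTop atTop)
    (htk : Tendsto (fun m => k m) atTop atTop)
    (hratio : Tendsto (fun m => (d m : ℝ) / (k m : ℝ)) atTop (nhds α)) :
    ∀ δ : ℝ, 0 < δ →
      Tendsto
        (fun m => gaussianMatrix (k m) (d m)
          {G | δ < |sigmaMax (1 - Gᵀ * G) - ((1 + Real.sqrt α) ^ 2 - 1)|})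
        atTop (nhds 0) := by
  intro δ hδ
  set a := Real.sqrt α with ha
  have ha0 : 0 < a := Real.sqrt_pos.2 hα0
  have ha1 : a ≤ 1 := Real.sqrt_le_one.2 hα1
  have haα : a ^ 2 = α := Real.sq_sqrt hα0.le
  obtain ⟨η₁, hη₁, hgt⟩ := gaussianMatrix_sigmaMax_gt_le ha0 ha1 hδ
  obtain ⟨η₂, hη₂, L, hlt⟩ := gaussianMatrix_sigmaMax_lt_le ha0 ha1 hδ
  rw [haα] at hgt hlt
  have hlim : Tendsto (fun m => 4 * ((k m : ℝ≥0∞) * normTail η₁ (k m)) +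
      2 * ((k m : ℝ≥0∞) * normTail η₂ (k m))) atTop (nhds 0) := by
    simpa using (tendsto_mul_normTail hη₁ htk 4 (by simp)).add
      (tendsto_mul_normTail hη₂ htk 2 (by simp))
  have hLk : Tendsto (fun m => (L : ℝ) / k m) atTop (nhds 0) :=
    tendsto_const_nhds.div_atTop (tendsto_natCast_atTop_atTop.comp htk)
  have hdist : Tendsto (fun m => |(d m : ℝ) / k m - α|) atTop (nhds 0) := by
    simpa using (hratio.sub_const α).abs
  refine tendsto_of_tendsto_of_tendsto_of_le_of_le' tendsto_const_nhds hlim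
    (Eventually.of_forall fun _ => bot_le) ?_
  filter_upwards [htd.eventually_ge_atTop (L + 1), hLk.eventually_le_const hη₂,
    hdist.eventually_le_const hη₁, hdist.eventually_le_const hη₂] with m hdL hLm h₁ h₂
  have hdkm := hdk m
  obtain ⟨n, hn⟩ : ∃ n, d m = n + 1 := ⟨d m - 1, by omega⟩
  rw [hn] at hdL hdkm h₁ h₂ ⊢
  refine (measure_mono fun G hG => ?_).trans ((measure_union_le _ _).trans
    (add_le_add (hgt (k m) n hdkm h₁) (hlt (k m) n hdkm (by omega) hLm h₂)))
  rcases lt_abs.1 (show δ < |_| from hG) with h | h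
  · exact Or.inl (show (1 + a) ^ 2 - 1 + δ < sigmaMax _ by linarith)
  · exact Or.inr (show sigmaMax _ < (1 + a) ^ 2 - 1 - δ by linarith)
end
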